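/- arXiv:2201.03241 — 12 statements merged into one kernel-verified Lean document; each statement's English description precedes it below -/
import Mathlib

section
/- Under Assumption A, the family of attractors is upper semicontinuous at every parameter: for every λ₀ ∈ Λ and every t ∈ ℝ, lim_{λ→λ₀} dist_{X_t}(A_λ(t), A_{λ₀}(t)) = 0. -/
open Filter Topology Set
open scoped ENNReal

/-- Hausdorff semidistance `dist(B,C) = sup_{x∈B} inf_{y∈C} d(x,y)` (in `ℝ≥0∞`). -/
noncomputable def hsd {α : Type*} [PseudoEMetricSpace α] (B C : Set α) : ℝ≥0∞ :=
  ⨆ x ∈ B, EMetric.infEdist x C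

/-- Under Assumption A, the family of pullback attractors is upper semicontinuous at
every parameter `λ₀` and every time `t`. -/
theorem upper_semicontinuity_of_pullback_attractors
    (X : ℝ → Type*) [∀ t, MetricSpace (X t)]
    (Λ : Type*) [MetricSpace Λ] [CompleteSpace Λ]
    (U : Λ → (t τ : ℝ) → X τ → X t)
    (hUid : ∀ (lam : Λ) (τ : ℝ) (x : X τ), U lam τ τ x = x)
    (hUcomp : ∀ (lam : Λ) (t s τ : ℝ), τ ≤ s → s ≤ t →
      ∀ x : X τ, U lam t s (U lam s τ x) = U lam t τ x)
    -- (L1) attractors: nonempty, compact, invariant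
    (A : Λ → (t : ℝ) → Set (X t))
    (hAne : ∀ lam t, (A lam t).Nonempty)
    (hAcpt : ∀ lam t, IsCompact (A lam t))
    (hAinv : ∀ (lam : Λ) (t τ : ℝ), τ ≤ t → U lam t τ '' A lam τ = A lam t)
    -- (L2)
    (B : (t : ℝ) → Set (X t)) (t₀ : ℝ)
    (hBne : ∀ t, (B t).Nonempty)
    (hAB : ∀ (lam : Λ) (t : ℝ), t ≤ t₀ → A lam t ⊆ B t)
    (hattr : ∀ (lam : Λ) (t : ℝ),
      Tendsto (fun τ : ℝ => hsd (U lam t τ '' B τ) (A lam t)) atBot (𝓝 0))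
    -- (L3)
    (hL3 : ∀ (t s : ℝ), s ≤ min t t₀ → ∀ lam₀ : Λ,
      Tendsto (fun lam : Λ => ⨆ x ∈ B s, edist (U lam t s x) (U lam₀ t s x))
        (𝓝 lam₀) (𝓝 0)) :
    ∀ (lam₀ : Λ) (t : ℝ),
      Tendsto (fun lam : Λ => hsd (A lam t) (A lam₀ t)) (𝓝 lam₀) (𝓝 0) := by
  intro lam₀ t
  rw [ENNReal.tendsto_nhds_zero]
  intro ε hε
  have hε2 : (0 : ℝ≥0∞) < ε / 2 := ENNReal.half_pos hε.ne'
  have h1 := (ENNReal.tendsto_nhds_zero.1 (hattr lam₀ t)) (ε / 2) hε2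
  obtain ⟨s, hs1, hs⟩ := (h1.and (eventually_le_atBot (min t t₀))).exists
  filter_upwards [(ENNReal.tendsto_nhds_zero.1 (hL3 t s hs lam₀)) (ε / 2) hε2] with lam hlam
  unfold hsd at hs1 ⊢
  refine iSup₂_le fun x hx => ?_
  rw [← hAinv lam t s (hs.trans (min_le_left _ _))] at hx
  obtain ⟨y, hy, rfl⟩ := hx
  have hyB : y ∈ B s := hAB lam s (hs.trans (min_le_right _ _)) hy
  have e1 : edist (U lam t s y) (U lam₀ t s y) ≤ ε / 2 :=
    (le_iSup₂ (f := fun x (_ : x ∈ B s) => edist (U lam t s x) (U lam₀ t s x)) y hyB).trans hlam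
  have e2 : EMetric.infEdist (U lam₀ t s y) (A lam₀ t) ≤ ε / 2 :=
    (le_iSup₂ (f := fun x (_ : x ∈ U lam₀ t s '' B s) => EMetric.infEdist x (A lam₀ t))
      _ (mem_image_of_mem _ hyB)).trans hs1
  calc EMetric.infEdist (U lam t s y) (A lam₀ t)
      ≤ EMetric.infEdist (U lam₀ t s y) (A lam₀ t) + edist (U lam t s y) (U lam₀ t s y) :=
        Metric.infEDist_le_infEDist_add_edist
    _ ≤ ε / 2 + ε / 2 := add_le_add e2 e1
    _ = ε := ENNReal.add_halves ε
end

section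
/- Under Assumption A, if in addition the metric space Λ is compact, then the family C = {C(t)}_{t∈ℝ} given by C(t) = ⋃_{λ∈Λ} A_λ(t) satisfies: (i) C(t) is a compact subset of X_t for each t ∈ ℝ; (ii) each A_λ pullback attracts C, that is, lim_{τ→−∞} dist_{X_t}(U_λ(t,τ)C(τ), A_λ(t)) = 0 for every t ∈ ℝ and λ ∈ Λ. -/
open Filter Topology Set
open scoped ENNReal

/-- Symmetric Hausdorff distance. -/
noncomputable def hsds {α : Type*} [PseudoEMetricSpace α] (B C : Set α) : ℝ≥0∞ :=
  max (hsd B C) (hsd C B)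

/-- Under Assumption A with `Λ` compact, the union family `C(t) = ⋃_λ A_λ(t)` has compact sections and is pullback attracted by each `A_λ`. -/
theorem compactness_and_attraction_of_union_of_attractors
    (X : ℝ → Type*) [∀ t, MetricSpace (X t)]
    (Λ : Type*) [MetricSpace Λ] [CompleteSpace Λ] [CompactSpace Λ]
    (U : Λ → (t τ : ℝ) → X τ → X t)
    (hUid : ∀ (lam : Λ) (τ : ℝ) (x : X τ), U lam τ τ x = x)
    (hUcomp : ∀ (lam : Λ) (t s τ : ℝ), τ ≤ s → s ≤ t →
      ∀ x : X τ, U lam t s (U lam s τ x) = U lam t τ x)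
    -- (L1) attractors: nonempty, compact, invariant
    (A : Λ → (t : ℝ) → Set (X t))
    (hAne : ∀ lam t, (A lam t).Nonempty)
    (hAcpt : ∀ lam t, IsCompact (A lam t))
    (hAinv : ∀ (lam : Λ) (t τ : ℝ), τ ≤ t → U lam t τ '' A lam τ = A lam t)
    -- (L2)
    (B : (t : ℝ) → Set (X t)) (t₀ : ℝ)
    (hBne : ∀ t, (B t).Nonempty)
    (hAB : ∀ (lam : Λ) (t : ℝ), t ≤ t₀ → A lam t ⊆ B t)
    (hattr : ∀ (lam : Λ) (t : ℝ),
      Tendsto (fun τ : ℝ => hsd (U lam t τ '' B τ) (A lam t)) atBot (𝓝 0))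
    -- (L3)
    (hL3 : ∀ (t s : ℝ), s ≤ min t t₀ → ∀ lam₀ : Λ,
      Tendsto (fun lam : Λ => ⨆ x ∈ B s, edist (U lam t s x) (U lam₀ t s x))
        (𝓝 lam₀) (𝓝 0)) :
    (∀ t : ℝ, IsCompact (⋃ lam : Λ, A lam t)) ∧
    (∀ (lam : Λ) (t : ℝ),
      Tendsto (fun τ : ℝ => hsd (U lam t τ '' ⋃ lam' : Λ, A lam' τ) (A lam t)) atBot (𝓝 0)) := by
  have husc : ∀ (t : ℝ) (lam₀ : Λ) (ε : ℝ≥0∞), 0 < ε →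
      ∀ᶠ lam in 𝓝 lam₀, ∀ x ∈ A lam t, EMetric.infEdist x (A lam₀ t) < ε := by
    intro t lam₀ ε hε
    have hε2 : 0 < ε / 2 := ENNReal.half_pos hε.ne'
    obtain ⟨s, hs1, hs2⟩ := (((hattr lam₀ t).eventually (gt_mem_nhds hε2)).and
      (eventually_le_atBot (min t t₀))).exists
    filter_upwards [(hL3 t s hs2 lam₀).eventually (gt_mem_nhds hε2)] with lam hlam x hx
    rw [← hAinv lam t s (hs2.trans (min_le_left _ _))] at hx
    obtain ⟨y, hy, rfl⟩ := hx
    have hyB : y ∈ B s := hAB lam s (hs2.trans (min_le_right _ _)) hy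
    have h1 : edist (U lam t s y) (U lam₀ t s y) < ε / 2 :=
      lt_of_le_of_lt (le_iSup₂ (f := fun x (_ : x ∈ B s) =>
        edist (U lam t s x) (U lam₀ t s x)) y hyB) hlam
    have h2 : EMetric.infEdist (U lam₀ t s y) (A lam₀ t) < ε / 2 :=
      lt_of_le_of_lt (le_iSup₂ (f := fun x (_ : x ∈ U lam₀ t s '' B s) =>
        EMetric.infEdist x (A lam₀ t)) _ (mem_image_of_mem _ hyB)) hs1
    calc EMetric.infEdist (U lam t s y) (A lam₀ t)
        ≤ EMetric.infEdist (U lam₀ t s y) (A lam₀ t) + edist (U lam t s y) (U lam₀ t s y) :=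
          Metric.infEDist_le_infEDist_add_edist
      _ < ε / 2 + ε / 2 := ENNReal.add_lt_add h2 h1
      _ = ε := ENNReal.add_halves ε
  refine ⟨?_, ?_⟩
  · intro t
    classical
    refine isCompact_of_finite_subcover ?_
    intro ι V hVo hV
    have h : ∀ lam₀ : Λ, ∃ I : Finset ι,
        ∀ᶠ lam in 𝓝 lam₀, A lam t ⊆ ⋃ i ∈ I, V i := by
      intro lam₀
      obtain ⟨I, hI⟩ := (hAcpt lam₀ t).elim_finite_subcover V hVo
        ((subset_iUnion (fun l => A l t) lam₀).trans hV)
      refine ⟨I, ?_⟩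
      obtain ⟨δ, hδ, hsub⟩ := (hAcpt lam₀ t).exists_thickening_subset_open
        (isOpen_biUnion fun i _ => hVo i) hI
      filter_upwards [husc t lam₀ (ENNReal.ofReal δ) (ENNReal.ofReal_pos.2 hδ)] with lam hl x hx
      exact hsub (hl x hx)
    choose I hI using h
    obtain ⟨F, hF⟩ := CompactSpace.elim_nhds_subcover _ hI
    refine ⟨F.biUnion I, ?_⟩
    intro x hx
    obtain ⟨lam, hx⟩ := mem_iUnion.1 hx
    have hm : lam ∈ ⋃ l ∈ F, {lam | A lam t ⊆ ⋃ i ∈ I l, V i} := by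
      have : lam ∈ (⊤ : Set Λ) := trivial
      rwa [← hF] at this
    obtain ⟨l, hl, hm⟩ := mem_iUnion₂.1 hm
    obtain ⟨i, hi, hxi⟩ := mem_iUnion₂.1 (hm hx)
    exact mem_iUnion₂.2 ⟨i, Finset.mem_biUnion.2 ⟨l, hl, hi⟩, hxi⟩
  · intro lam t
    refine tendsto_of_tendsto_of_tendsto_of_le_of_le' tendsto_const_nhds (hattr lam t)
      (Eventually.of_forall fun _ => zero_le) ?_
    filter_upwards [eventually_le_atBot t₀] with τ hτ
    exact biSup_mono fun x hx => image_mono (iUnion_subset fun l => hAB l τ hτ) hx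
end

section
/- Under Assumption A, if in addition each map U_λ(t,τ): X_τ → X_t is continuous (for every τ ≤ t and λ ∈ Λ) and B(t) is compact in X_t for all t ≤ t₀, then there exists a residual subset Λ* of Λ such that for every λ₀ ∈ Λ* and every t ∈ ℝ, lim_{λ→λ₀} dist^symm_{X_t}(A_λ(t), A_{λ₀}(t)) = 0. -/
open Filter Topology Set
open scoped ENNReal

theorem aux_hsd_lt {α : Type*} [PseudoEMetricSpace α] {P Q : Set α} {ε : ℝ≥0∞}
    (h : hsd P Q < ε) {x : α} (hx : x ∈ P) : ∃ y ∈ Q, edist x y < ε := by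
  have h1 : EMetric.infEdist x Q ≤ hsd P Q :=
    le_iSup₂ (f := fun x (_ : x ∈ P) => EMetric.infEdist x Q) x hx
  exact EMetric.infEdist_lt_iff.1 (h1.trans_lt h)

theorem aux_hsd_le {α : Type*} [PseudoEMetricSpace α] {P Q : Set α} {ε : ℝ≥0∞}
    (h : ∀ x ∈ P, ∃ y ∈ Q, edist x y ≤ ε) : hsd P Q ≤ ε := by
  refine iSup₂_le fun x hx => ?_
  obtain ⟨y, hy, hxy⟩ := h x hx
  exact (EMetric.infEdist_le_edist_of_mem hy).trans hxy

theorem aux_generic {α Λ : Type*} [MetricSpace α] [TopologicalSpace Λ] (A : Λ → Set α)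
    (hA : ∀ l, IsCompact (A l)) (K : Set α) (hK : IsCompact K) (hAK : ∀ l, A l ⊆ K)
    (husc : ∀ l₀, Tendsto (fun l => hsd (A l) (A l₀)) (𝓝 l₀) (𝓝 0)) :
    ∀ᶠ l₀ in residual Λ, Tendsto (fun l => hsd (A l₀) (A l)) (𝓝 l₀) (𝓝 0) := by
  obtain ⟨c, hc, hKc⟩ := hK.isSeparable
  let F : α → ℕ → Set Λ := fun x n => {l | (A l ∩ Metric.closedBall x (1 / ((n : ℝ) + 1))).Nonempty}
  have hF : ∀ x n, IsClosed (F x n) := by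
    intro x n
    rw [← isOpen_compl_iff, isOpen_iff_mem_nhds]
    intro l₀ hl₀
    have hsub : A l₀ ⊆ (Metric.closedBall x (1 / ((n : ℝ) + 1)))ᶜ := by
      intro y hy hy'
      exact hl₀ ⟨y, hy, hy'⟩
    obtain ⟨δ, hδ, hth⟩ := (hA l₀).exists_thickening_subset_open
      Metric.isClosed_closedBall.isOpen_compl hsub
    filter_upwards [(husc l₀).eventually_lt_const (ENNReal.ofReal_pos.2 hδ)] with l hl
    rintro ⟨y, hy, hy'⟩
    obtain ⟨z, hz, hyz⟩ := aux_hsd_lt hl hy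
    refine hth (Metric.mem_thickening_iff.2 ⟨z, hz, ?_⟩) hy'
    rw [edist_dist] at hyz
    exact (ENNReal.ofReal_lt_ofReal_iff hδ).1 hyz
  have hres : ∀ᶠ l₀ in residual Λ, ∀ x ∈ c, ∀ n, l₀ ∈ (frontier (F x n))ᶜ := by
    rw [eventually_countable_ball hc]
    intro x _
    rw [eventually_countable_forall]
    intro n
    exact residual_of_dense_open isClosed_frontier.isOpen_compl
      (interior_eq_empty_iff_dense_compl.1 (interior_frontier (hF x n)))
  filter_upwards [hres] with l₀ h
  rw [ENNReal.tendsto_nhds_zero]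
  intro ε hε
  obtain ⟨r, hr0, hr⟩ : ∃ r : ℝ, 0 < r ∧ ENNReal.ofReal r ≤ ε := by
    obtain ⟨r, hr0, hr⟩ := ENNReal.lt_iff_exists_nnreal_btwn.1 hε
    exact ⟨r, by exact_mod_cast hr0, by simpa using hr.le⟩
  obtain ⟨n, hn⟩ := exists_nat_one_div_lt (half_pos hr0)
  have hpos : (0:ℝ) < 1 / ((n : ℝ) + 1) := by positivity
  obtain ⟨T, hTc, hTf, hT⟩ : ∃ T : Set α, T ⊆ c ∧ T.Finite ∧
      A l₀ ⊆ ⋃ x ∈ T, Metric.ball x (1 / ((n : ℝ) + 1)) := by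
    refine (hA l₀).elim_finite_subcover_image (fun x _ => Metric.isOpen_ball) ?_
    intro y hy
    obtain ⟨x, hx, hxy⟩ := Metric.mem_closure_iff.1 (hKc (hAK l₀ hy)) _ hpos
    exact mem_iUnion₂.2 ⟨x, hx, hxy⟩
  have hev : ∀ᶠ l in 𝓝 l₀, ∀ x ∈ T, l₀ ∈ F x n → l ∈ F x n := by
    rw [eventually_all_finite hTf]
    intro x hx
    by_cases hm : l₀ ∈ F x n
    · have h1 := h x (hTc hx) n
      have h2 : l₀ ∈ interior (F x n) := by
        by_contra h3
        exact h1 ⟨subset_closure hm, h3⟩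
      filter_upwards [mem_interior_iff_mem_nhds.1 h2] with l hl _ using hl
    · exact Eventually.of_forall fun l h => absurd h hm
  filter_upwards [hev] with l hl
  refine aux_hsd_le fun y hy => ?_
  obtain ⟨x, hx, hyx⟩ := mem_iUnion₂.1 (hT hy)
  obtain ⟨z, hz, hzx⟩ := hl x hx ⟨y, hy, Metric.ball_subset_closedBall hyx⟩
  refine ⟨z, hz, le_trans ?_ hr⟩
  rw [edist_dist]
  apply ENNReal.ofReal_le_ofReal
  have := dist_triangle_right y z x
  rw [Metric.mem_ball] at hyx
  rw [Metric.mem_closedBall] at hzx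
  linarith

/-- Under Assumption A, if the process maps are continuous and the sections `B(t)`, `t ≤ t₀`, are compact, then the attractors are continuous on a residual subset of `Λ`. -/
theorem residual_continuity_of_pullback_attractors_compact_B
    (X : ℝ → Type*) [∀ t, MetricSpace (X t)]
    (Λ : Type*) [MetricSpace Λ] [CompleteSpace Λ]
    (U : Λ → (t τ : ℝ) → X τ → X t)
    (hUid : ∀ (lam : Λ) (τ : ℝ) (x : X τ), U lam τ τ x = x)
    (hUcomp : ∀ (lam : Λ) (t s τ : ℝ), τ ≤ s → s ≤ t →
      ∀ x : X τ, U lam t s (U lam s τ x) = U lam t τ x)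
    -- (L1) attractors: nonempty, compact, invariant
    (A : Λ → (t : ℝ) → Set (X t))
    (hAne : ∀ lam t, (A lam t).Nonempty)
    (hAcpt : ∀ lam t, IsCompact (A lam t))
    (hAinv : ∀ (lam : Λ) (t τ : ℝ), τ ≤ t → U lam t τ '' A lam τ = A lam t)
    -- (L2)
    (B : (t : ℝ) → Set (X t)) (t₀ : ℝ)
    (hBne : ∀ t, (B t).Nonempty)
    (hAB : ∀ (lam : Λ) (t : ℝ), t ≤ t₀ → A lam t ⊆ B t)
    (hattr : ∀ (lam : Λ) (t : ℝ),
      Tendsto (fun τ : ℝ => hsd (U lam t τ '' B τ) (A lam t)) atBot (𝓝 0))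
    -- (L3)
    (hL3 : ∀ (t s : ℝ), s ≤ min t t₀ → ∀ lam₀ : Λ,
      Tendsto (fun lam : Λ => ⨆ x ∈ B s, edist (U lam t s x) (U lam₀ t s x))
        (𝓝 lam₀) (𝓝 0))
    -- continuity of the process maps
    (hUcont : ∀ (lam : Λ) (t τ : ℝ), τ ≤ t → Continuous (U lam t τ))
    -- compactness of the sections of B
    (hBcpt : ∀ t : ℝ, t ≤ t₀ → IsCompact (B t)) :
    ∃ S : Set Λ, S ∈ residual Λ ∧ ∀ lam₀ ∈ S, ∀ t : ℝ,
      Tendsto (fun lam : Λ => hsds (A lam t) (A lam₀ t)) (𝓝 lam₀) (𝓝 0) := by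
  have husc : ∀ (t : ℝ) (l₀ : Λ), Tendsto (fun l => hsd (A l t) (A l₀ t)) (𝓝 l₀) (𝓝 0) := by
    intro t l₀
    rw [ENNReal.tendsto_nhds_zero]
    intro ε hε
    have hε2 : 0 < ε / 2 := ENNReal.half_pos hε.ne'
    obtain ⟨s, hs, hst⟩ := (((hattr l₀ t).eventually_lt_const hε2).and
      (eventually_le_atBot (min t t₀))).exists
    filter_upwards [(hL3 t s hst l₀).eventually_lt_const hε2] with l hl
    refine aux_hsd_le fun x hx => ?_
    rw [← hAinv l t s (hst.trans (min_le_left _ _))] at hx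
    obtain ⟨y, hy, rfl⟩ := hx
    have hyB := hAB l s (hst.trans (min_le_right _ _)) hy
    obtain ⟨z, hz, hyz⟩ := aux_hsd_lt hs (mem_image_of_mem _ hyB)
    refine ⟨z, hz, ?_⟩
    have h1 : edist (U l t s y) (U l₀ t s y) ≤ ε / 2 :=
      (le_iSup₂ (f := fun x (_ : x ∈ B s) => edist (U l t s x) (U l₀ t s x)) y hyB).trans hl.le
    calc _ ≤ _ := edist_triangle _ (U l₀ t s y) _
      _ ≤ ε / 2 + ε / 2 := add_le_add h1 hyz.le
      _ = ε := ENNReal.add_halves ε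
  have hgen : ∀ᶠ l₀ in residual Λ, ∀ n : ℕ,
      Tendsto (fun l => hsd (A l₀ (t₀ - n)) (A l (t₀ - n))) (𝓝 l₀) (𝓝 0) := by
    rw [eventually_countable_forall]
    intro n
    have hn : t₀ - n ≤ t₀ := by simp
    exact aux_generic (fun l => A l (t₀ - n)) (fun l => hAcpt l _) (B (t₀ - n)) (hBcpt _ hn)
      (fun l => hAB l _ hn) (husc _)
  refine ⟨_, hgen, fun l₀ hl₀ t => ?_⟩
  have hlsc : Tendsto (fun l => hsd (A l₀ t) (A l t)) (𝓝 l₀) (𝓝 0) := by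
    obtain ⟨n, hn⟩ := exists_nat_ge (t₀ - t)
    have hl := hl₀ n
    have hst : t₀ - (n : ℝ) ≤ t := by linarith
    have hs0 : t₀ - (n : ℝ) ≤ t₀ := by simp
    generalize t₀ - (n : ℝ) = s at hl hst hs0
    rw [ENNReal.tendsto_nhds_zero]
    intro ε hε
    have hε2 : 0 < ε / 2 := ENNReal.half_pos hε.ne'
    obtain ⟨δ, hδ, huc⟩ := EMetric.uniformContinuousOn_iff.1
      ((hBcpt s hs0).uniformContinuousOn_of_continuous (hUcont l₀ t s hst).continuousOn) _ hε2
    filter_upwards [(hL3 t s (le_min hst hs0) l₀).eventually_lt_const hε2,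
      hl.eventually_lt_const hδ] with l h3 h4
    refine aux_hsd_le fun x hx => ?_
    rw [← hAinv l₀ t s hst] at hx
    obtain ⟨y, hy, rfl⟩ := hx
    obtain ⟨z, hz, hyz⟩ := aux_hsd_lt h4 hy
    have hzB := hAB l s hs0 hz
    refine ⟨U l t s z, by rw [← hAinv l t s hst]; exact mem_image_of_mem _ hz, ?_⟩
    have h1 : edist (U l t s z) (U l₀ t s z) ≤ ε / 2 :=
      (le_iSup₂ (f := fun x (_ : x ∈ B s) => edist (U l t s x) (U l₀ t s x)) z hzB).trans h3.le
    rw [edist_comm] at h1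
    have h2 := huc (hAB l₀ s hs0 hy) hzB hyz
    calc _ ≤ _ := edist_triangle _ (U l₀ t s z) _
      _ ≤ ε / 2 + ε / 2 := add_le_add h2.le h1
      _ = ε := ENNReal.add_halves ε
  simpa [hsds] using (husc t l₀).max hlsc
end

section
/- Under Assumption A, if in addition each map U_λ(t,τ): X_τ → X_t is continuous (for every τ ≤ t and λ ∈ Λ) and the metric space Λ is compact, then there exists a residual subset Λ* of Λ such that for every λ₀ ∈ Λ* and every t ∈ ℝ, lim_{λ→λ₀} dist^symm_{X_t}(A_λ(t), A_{λ₀}(t)) = 0. -/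
open Filter Topology Set
open scoped ENNReal

theorem hsds_eq {α : Type*} [PseudoEMetricSpace α] (s t : Set α) :
    hsds s t = Metric.hausdorffEDist s t := by
  rw [Metric.hausdorffEDist_def]; rfl

theorem haus_image_le {α β : Type*} [PseudoEMetricSpace β] (f g : α → β) (C : Set α) (r : ℝ≥0∞)
    (h : ∀ x ∈ C, edist (f x) (g x) ≤ r) : Metric.hausdorffEDist (f '' C) (g '' C) ≤ r := by
  apply Metric.hausdorffEDist_le_of_mem_edist
  · rintro _ ⟨x, hx, rfl⟩
    exact ⟨g x, ⟨x, hx, rfl⟩, h x hx⟩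
  · rintro _ ⟨x, hx, rfl⟩
    exact ⟨f x, ⟨x, hx, rfl⟩, by rw [edist_comm]; exact h x hx⟩

theorem residual_of_pointwise_limit {Λ Y : Type*} [TopologicalSpace Λ] [BaireSpace Λ]
    [PseudoEMetricSpace Y] (f : ℕ → Λ → Set Y) (F : Λ → Set Y)
    (hc : ∀ k l₀, Tendsto (fun l => Metric.hausdorffEDist (f k l) (f k l₀)) (𝓝 l₀) (𝓝 0))
    (hl : ∀ l, Tendsto (fun k => Metric.hausdorffEDist (f k l) (F l)) atTop (𝓝 0)) :
    ∃ S : Set Λ, S ∈ residual Λ ∧ ∀ l₀ ∈ S,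
      Tendsto (fun l => Metric.hausdorffEDist (F l) (F l₀)) (𝓝 l₀) (𝓝 0) := by
  let P : ℝ≥0∞ → ℕ → Set Λ := fun e n =>
    {l | ∀ m, n ≤ m → Metric.hausdorffEDist (f n l) (f m l) ≤ e}
  have hPc : ∀ e n, IsClosed (P e n) := by
    intro e n
    rw [isClosed_iff_clusterPt]
    intro l₀ hl₀ m hm
    have hne : (𝓝[P e n] l₀).NeBot := hl₀
    have h1 : Tendsto (fun l => Metric.hausdorffEDist (f n l) (f n l₀) +
        (e + Metric.hausdorffEDist (f m l) (f m l₀))) (𝓝[P e n] l₀) (𝓝 (0 + (e + 0))) :=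
      ((hc n l₀).mono_left nhdsWithin_le_nhds).add
        (tendsto_const_nhds.add ((hc m l₀).mono_left nhdsWithin_le_nhds))
    rw [zero_add, add_zero] at h1
    refine ge_of_tendsto h1 ?_
    filter_upwards [self_mem_nhdsWithin] with l hlP
    calc Metric.hausdorffEDist (f n l₀) (f m l₀)
        ≤ Metric.hausdorffEDist (f n l₀) (f n l) + Metric.hausdorffEDist (f n l) (f m l₀) :=
          Metric.hausdorffEDist_triangle
      _ ≤ Metric.hausdorffEDist (f n l₀) (f n l) + (Metric.hausdorffEDist (f n l) (f m l) +
            Metric.hausdorffEDist (f m l) (f m l₀)) := by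
          gcongr; exact Metric.hausdorffEDist_triangle
      _ ≤ _ := by
          rw [Metric.hausdorffEDist_comm (s := f n l₀)]
          gcongr
          exact hlP m hm
  have hPu : ∀ e, 0 < e → ⋃ n, P e n = univ := by
    intro e he
    rw [eq_univ_iff_forall]
    intro l
    obtain ⟨n, hn⟩ := eventually_atTop.1
      (ENNReal.tendsto_nhds_zero.1 (hl l) (e / 2) (ENNReal.half_pos he.ne'))
    refine mem_iUnion.2 ⟨n, fun m hm => ?_⟩
    calc Metric.hausdorffEDist (f n l) (f m l)
        ≤ Metric.hausdorffEDist (f n l) (F l) + Metric.hausdorffEDist (F l) (f m l) :=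
          Metric.hausdorffEDist_triangle
      _ ≤ e / 2 + e / 2 := by
          gcongr
          · exact hn n le_rfl
          · rw [Metric.hausdorffEDist_comm]; exact hn m hm
      _ = e := ENNReal.add_halves e
  refine ⟨⋂ j : ℕ, ⋃ n, interior (P ((j : ℝ≥0∞)⁻¹) n), ?_, ?_⟩
  · refine countable_iInter_mem.2 fun j => ?_
    exact residual_of_dense_open (isOpen_iUnion fun n => isOpen_interior)
      (dense_iUnion_interior_of_closed (fun n => hPc _ n)
        (hPu _ (ENNReal.inv_pos.2 (ENNReal.natCast_ne_top j))))
  · intro l₀ hl₀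
    rw [ENNReal.tendsto_nhds_zero]
    intro ε hε
    have h3 : 0 < ε / 3 := ENNReal.div_pos hε.ne' (by norm_num)
    obtain ⟨j, hj⟩ := (ENNReal.tendsto_nhds_zero.1 ENNReal.tendsto_inv_nat_nhds_zero _ h3).exists
    obtain ⟨n, hn⟩ := mem_iUnion.1 (mem_iInter.1 hl₀ j)
    have key : ∀ l ∈ P ((j : ℝ≥0∞)⁻¹) n, Metric.hausdorffEDist (f n l) (F l) ≤ ε / 3 := by
      intro l hlP
      refine le_trans ?_ hj
      have h1 : Tendsto (fun m => (j : ℝ≥0∞)⁻¹ + Metric.hausdorffEDist (f m l) (F l)) atTop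
          (𝓝 ((j : ℝ≥0∞)⁻¹ + 0)) := tendsto_const_nhds.add (hl l)
      rw [add_zero] at h1
      refine ge_of_tendsto h1 ?_
      filter_upwards [eventually_ge_atTop n] with m hm
      refine Metric.hausdorffEDist_triangle (t := f m l) |>.trans ?_
      gcongr
      exact hlP m hm
    filter_upwards [isOpen_interior.mem_nhds hn, ENNReal.tendsto_nhds_zero.1 (hc n l₀) _ h3]
      with l h1 h2
    calc Metric.hausdorffEDist (F l) (F l₀)
        ≤ Metric.hausdorffEDist (F l) (f n l) + Metric.hausdorffEDist (f n l) (F l₀) :=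
          Metric.hausdorffEDist_triangle
      _ ≤ Metric.hausdorffEDist (F l) (f n l) + (Metric.hausdorffEDist (f n l) (f n l₀) +
            Metric.hausdorffEDist (f n l₀) (F l₀)) := by
          gcongr; exact Metric.hausdorffEDist_triangle
      _ ≤ ε / 3 + (ε / 3 + ε / 3) := by
          gcongr
          · rw [Metric.hausdorffEDist_comm]; exact key l (interior_subset h1)
          · exact key l₀ (interior_subset hn)
      _ = ε := by rw [← add_assoc]; exact ENNReal.add_thirds ε

theorem haus_image_compact {α β : Type*} [PseudoEMetricSpace α] [PseudoEMetricSpace β]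
    (g : α → β) (hg : Continuous g) (K : Set α) (hK : IsCompact K) (ε : ℝ≥0∞) (hε : 0 < ε) :
    ∃ δ > 0, ∀ C : Set α, Metric.hausdorffEDist C K < δ →
      Metric.hausdorffEDist (g '' C) (g '' K) ≤ ε := by
  have h := hK.uniformContinuousAt_of_continuousAt g (fun x _ => hg.continuousAt)
    (edist_mem_uniformity hε)
  obtain ⟨δ, hδ, h⟩ := mem_uniformity_edist.1 h
  refine ⟨δ, hδ, fun C hC => ?_⟩
  apply Metric.hausdorffEDist_le_of_mem_edist
  · rintro _ ⟨x, hx, rfl⟩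
    obtain ⟨y, hy, hxy⟩ := Metric.exists_edist_lt_of_hausdorffEDist_lt hx hC
    refine ⟨g y, ⟨y, hy, rfl⟩, ?_⟩
    rw [edist_comm] at hxy ⊢
    exact le_of_lt (h hxy hy)
  · rintro _ ⟨x, hx, rfl⟩
    rw [Metric.hausdorffEDist_comm] at hC
    obtain ⟨y, hy, hxy⟩ := Metric.exists_edist_lt_of_hausdorffEDist_lt hx hC
    exact ⟨g y, ⟨y, hy, rfl⟩, le_of_lt (h hxy hx)⟩

/-- Under Assumption A, if the process maps are continuous and `Λ` is compact, then the attractors are continuous on a residual subset of `Λ`. -/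
theorem residual_continuity_of_pullback_attractors_compact_Lambda
    (X : ℝ → Type*) [∀ t, MetricSpace (X t)]
    (Λ : Type*) [MetricSpace Λ] [CompleteSpace Λ] [CompactSpace Λ]
    (U : Λ → (t τ : ℝ) → X τ → X t)
    (hUid : ∀ (lam : Λ) (τ : ℝ) (x : X τ), U lam τ τ x = x)
    (hUcomp : ∀ (lam : Λ) (t s τ : ℝ), τ ≤ s → s ≤ t →
      ∀ x : X τ, U lam t s (U lam s τ x) = U lam t τ x)
    -- (L1) attractors: nonempty, compact, invariant
    (A : Λ → (t : ℝ) → Set (X t))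
    (hAne : ∀ lam t, (A lam t).Nonempty)
    (hAcpt : ∀ lam t, IsCompact (A lam t))
    (hAinv : ∀ (lam : Λ) (t τ : ℝ), τ ≤ t → U lam t τ '' A lam τ = A lam t)
    -- (L2)
    (B : (t : ℝ) → Set (X t)) (t₀ : ℝ)
    (hBne : ∀ t, (B t).Nonempty)
    (hAB : ∀ (lam : Λ) (t : ℝ), t ≤ t₀ → A lam t ⊆ B t)
    (hattr : ∀ (lam : Λ) (t : ℝ),
      Tendsto (fun τ : ℝ => hsd (U lam t τ '' B τ) (A lam t)) atBot (𝓝 0))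
    -- (L3)
    (hL3 : ∀ (t s : ℝ), s ≤ min t t₀ → ∀ lam₀ : Λ,
      Tendsto (fun lam : Λ => ⨆ x ∈ B s, edist (U lam t s x) (U lam₀ t s x))
        (𝓝 lam₀) (𝓝 0))
    -- continuity of the process maps
    (hUcont : ∀ (lam : Λ) (t τ : ℝ), τ ≤ t → Continuous (U lam t τ)) :
    ∃ S : Set Λ, S ∈ residual Λ ∧ ∀ lam₀ ∈ S, ∀ t : ℝ,
      Tendsto (fun lam : Λ => hsds (A lam t) (A lam₀ t)) (𝓝 lam₀) (𝓝 0) := by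
  simp only [hsds_eq]
  have main : ∀ t : ℝ, ∃ S : Set Λ, S ∈ residual Λ ∧ ∀ l₀ ∈ S,
      Tendsto (fun l => Metric.hausdorffEDist (A l t) (A l₀ t)) (𝓝 l₀) (𝓝 0) := by
    intro t
    let s : ℕ → ℝ := fun k => min t t₀ - k
    have hs : ∀ k, s k ≤ min t t₀ := fun k => sub_le_self _ (Nat.cast_nonneg k)
    have hsl : Tendsto s atTop atBot := by
      have := tendsto_atBot_add_const_left atTop (min t t₀)
        (tendsto_neg_atTop_atBot.comp (tendsto_natCast_atTop_atTop (R := ℝ)))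
      simpa [s, sub_eq_add_neg, Function.comp_def] using this
    refine residual_of_pointwise_limit (fun k l => U l t (s k) '' B (s k)) (fun l => A l t) ?_ ?_
    · intro k l₀
      refine tendsto_of_tendsto_of_tendsto_of_le_of_le tendsto_const_nhds (hL3 t (s k) (hs k) l₀)
        (fun l => zero_le) (fun l => ?_)
      exact haus_image_le _ _ _ _ fun x hx =>
        le_iSup₂ (f := fun x (_ : x ∈ B (s k)) => edist (U l t (s k) x) (U l₀ t (s k) x)) x hx
    · intro l
      have h := (hattr l t).comp hsl
      refine tendsto_of_tendsto_of_tendsto_of_le_of_le tendsto_const_nhds h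
        (fun l => zero_le) (fun k => ?_)
      rw [← hsds_eq]
      refine max_le le_rfl ?_
      have hsub : A l t ⊆ U l t (s k) '' B (s k) := by
        rw [← hAinv l t (s k) ((hs k).trans (min_le_left _ _))]
        exact image_mono (hAB l _ ((hs k).trans (min_le_right _ _)))
      refine iSup₂_le fun x hx => ?_
      exact (Metric.infEDist_zero_of_mem (hsub hx)).le.trans zero_le
  choose S hS hcont using fun n : ℕ => main (-(n : ℝ))
  refine ⟨⋂ n, S n, countable_iInter_mem.2 hS, fun l₀ hl₀ t => ?_⟩
  obtain ⟨n, hn⟩ := exists_nat_ge (-(min t t₀))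
  have hn' : -(n : ℝ) ≤ min t t₀ := by linarith
  have hnt := hn'.trans (min_le_left _ _)
  have hn0 := hn'.trans (min_le_right _ _)
  have hc := hcont n l₀ (mem_iInter.1 hl₀ n)
  rw [ENNReal.tendsto_nhds_zero]
  intro ε hε
  have h2 : 0 < ε / 2 := ENNReal.half_pos hε.ne'
  obtain ⟨δ, hδ, hK⟩ := haus_image_compact (U l₀ t (-(n : ℝ))) (hUcont l₀ t _ hnt)
    (A l₀ (-(n : ℝ))) (hAcpt l₀ _) _ h2
  filter_upwards [hc.eventually_lt_const hδ,
    ENNReal.tendsto_nhds_zero.1 (hL3 t _ hn' l₀) _ h2] with l h3 h4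
  rw [← hAinv l t _ hnt, ← hAinv l₀ t _ hnt]
  refine Metric.hausdorffEDist_triangle (t := U l₀ t (-(n : ℝ)) '' A l (-(n : ℝ))) |>.trans ?_
  refine (add_le_add ?_ (hK _ h3)).trans (ENNReal.add_halves ε).le
  refine haus_image_le _ _ _ _ fun x hx => le_trans ?_ h4
  exact le_iSup₂ (f := fun x (_ : x ∈ B (-(n : ℝ))) =>
    edist (U l t (-(n : ℝ)) x) (U l₀ t (-(n : ℝ)) x)) x (hAB l _ hn0 hx)
end

section
/- Under Assumption A, if in addition each map U_λ(t,τ): X_τ → X_t is continuous (for every τ ≤ t and λ ∈ Λ) and B(t) is compact in X_t for all t ≤ t₀, then for every t ∈ ℝ and every s ≤ min{t,t₀}, the mapping (λ,B) ↦ U_λ(t,s)B is continuous at every point (λ₀,B₀) ∈ Λ × CB(B(s)); that is, for every ε > 0 there is δ > 0 such that dist^symm_{X_t}(U_λ(t,s)B, U_{λ₀}(t,s)B₀) ≤ ε whenever λ ∈ Λ, B ∈ CB(B(s)), ρ(λ,λ₀) < δ and dist^symm_{X_s}(B,B₀) < δ. Here CB(B(s)) denotes the collection of nonempty closed subsets of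 B(s). -/
open Filter Topology Set
open scoped ENNReal

/-- Under Assumption A with continuous process maps and compact sections `B(t)`, `t ≤ t₀`: the map `(λ,B) ↦ U_λ(t,s)B` is continuous at every point of `Λ × CB(B(s))`. -/
theorem joint_continuity_of_process_on_closed_subsets
    (X : ℝ → Type*) [∀ t, MetricSpace (X t)]
    (Λ : Type*) [MetricSpace Λ] [CompleteSpace Λ]
    (U : Λ → (t τ : ℝ) → X τ → X t)
    (hUid : ∀ (lam : Λ) (τ : ℝ) (x : X τ), U lam τ τ x = x)
    (hUcomp : ∀ (lam : Λ) (t s τ : ℝ), τ ≤ s → s ≤ t →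
      ∀ x : X τ, U lam t s (U lam s τ x) = U lam t τ x)
    -- (L1) attractors: nonempty, compact, invariant
    (A : Λ → (t : ℝ) → Set (X t))
    (hAne : ∀ lam t, (A lam t).Nonempty)
    (hAcpt : ∀ lam t, IsCompact (A lam t))
    (hAinv : ∀ (lam : Λ) (t τ : ℝ), τ ≤ t → U lam t τ '' A lam τ = A lam t)
    -- (L2)
    (B : (t : ℝ) → Set (X t)) (t₀ : ℝ)
    (hBne : ∀ t, (B t).Nonempty)
    (hAB : ∀ (lam : Λ) (t : ℝ), t ≤ t₀ → A lam t ⊆ B t)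
    (hattr : ∀ (lam : Λ) (t : ℝ),
      Tendsto (fun τ : ℝ => hsd (U lam t τ '' B τ) (A lam t)) atBot (𝓝 0))
    -- (L3)
    (hL3 : ∀ (t s : ℝ), s ≤ min t t₀ → ∀ lam₀ : Λ,
      Tendsto (fun lam : Λ => ⨆ x ∈ B s, edist (U lam t s x) (U lam₀ t s x))
        (𝓝 lam₀) (𝓝 0))
    -- continuity of the process maps
    (hUcont : ∀ (lam : Λ) (t τ : ℝ), τ ≤ t → Continuous (U lam t τ))
    -- compactness of the sections of B
    (hBcpt : ∀ t : ℝ, t ≤ t₀ → IsCompact (B t)) :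
    ∀ (t s : ℝ), s ≤ min t t₀ → ∀ (lam₀ : Λ) (B₀ : Set (X s)),
      B₀.Nonempty → IsClosed B₀ → B₀ ⊆ B s →
      ∀ ε : ℝ, 0 < ε → ∃ δ : ℝ, 0 < δ ∧
        ∀ (lam : Λ) (B' : Set (X s)), B'.Nonempty → IsClosed B' → B' ⊆ B s →
          dist lam lam₀ < δ → hsds B' B₀ < ENNReal.ofReal δ →
          hsds (U lam t s '' B') (U lam₀ t s '' B₀) ≤ ENNReal.ofReal ε := by
  intro t s hs lam₀ B₀ hB₀ne hB₀c hB₀ ε hε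
  have hst : s ≤ t := le_trans hs (min_le_left _ _)
  have hst0 : s ≤ t₀ := le_trans hs (min_le_right _ _)
  have huc := (hBcpt s hst0).uniformContinuousOn_of_continuous (hUcont lam₀ t s hst).continuousOn
  obtain ⟨η, hη, huc⟩ := Metric.uniformContinuousOn_iff.1 huc (ε / 2) (half_pos hε)
  have hev := (hL3 t s hs lam₀).eventually
    (gt_mem_nhds (ENNReal.ofReal_pos.2 (half_pos hε)))
  obtain ⟨δ, hδ, hev⟩ := Metric.eventually_nhds_iff.1 hev
  refine ⟨min δ η, lt_min hδ hη, ?_⟩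
  intro lam B' hB'ne hB'c hB' hlam hd
  have h1 := hev (lt_of_lt_of_le hlam (min_le_left _ _))
  have key : ∀ x ∈ B s, ∀ y ∈ B s, edist x y < ENNReal.ofReal (min δ η) →
      edist (U lam t s x) (U lam₀ t s y) ≤ ENNReal.ofReal ε := by
    intro x hx y hy hxy
    have hxy' : dist x y < η := by
      rw [edist_dist, ENNReal.ofReal_lt_ofReal_iff (lt_min hδ hη)] at hxy
      exact lt_of_lt_of_le hxy (min_le_right _ _)
    have h2 : edist (U lam t s x) (U lam₀ t s x) ≤ ENNReal.ofReal (ε / 2) :=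
      le_trans (le_iSup₂ (f := fun x (_ : x ∈ B s) =>
        edist (U lam t s x) (U lam₀ t s x)) x hx) h1.le
    have h3 : edist (U lam₀ t s x) (U lam₀ t s y) ≤ ENNReal.ofReal (ε / 2) := by
      rw [edist_dist]
      exact ENNReal.ofReal_le_ofReal (huc x hx y hy hxy').le
    calc edist (U lam t s x) (U lam₀ t s y) ≤ _ := edist_triangle _ (U lam₀ t s x) _
      _ ≤ ENNReal.ofReal (ε / 2) + ENNReal.ofReal (ε / 2) := add_le_add h2 h3
      _ = ENNReal.ofReal ε := by
        rw [← ENNReal.ofReal_add (half_pos hε).le (half_pos hε).le, add_halves]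
  obtain ⟨hd1, hd2⟩ := max_lt_iff.1 hd
  refine max_le ?_ ?_
  · refine iSup₂_le ?_
    rintro _ ⟨x, hx, rfl⟩
    have h := lt_of_le_of_lt (le_iSup₂ (f := fun x (_ : x ∈ B') =>
      Metric.infEDist x B₀) x hx) hd1
    obtain ⟨y, hy, hxy⟩ := Metric.infEDist_lt_iff.1 h
    exact le_trans (Metric.infEDist_le_edist_of_mem (mem_image_of_mem _ hy))
      (key x (hB' hx) y (hB₀ hy) hxy)
  · refine iSup₂_le ?_
    rintro _ ⟨x, hx, rfl⟩
    have h := lt_of_le_of_lt (le_iSup₂ (f := fun x (_ : x ∈ B₀) =>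
      Metric.infEDist x B') x hx) hd2
    obtain ⟨y, hy, hxy⟩ := Metric.infEDist_lt_iff.1 h
    refine le_trans (Metric.infEDist_le_edist_of_mem (mem_image_of_mem _ hy)) ?_
    rw [edist_comm] at hxy ⊢
    exact key y (hB' hy) x (hB₀ hx) hxy
end

section
/- Under Assumption A, with each map U_λ(t,τ): X_τ → X_t continuous and B(t) compact in X_t for all t ≤ t₀, fix t ∈ ℝ. If the family B satisfies the pullback equi-attraction at time t, namely lim_{s→−∞} sup_{λ∈Λ} dist_{X_t}(U_λ(t,s)B(s), A_λ(t)) = 0, then the mapping λ ↦ A_λ(t) is continuous on Λ with respect to the symmetric Hausdorff distance: lim_{λ→λ₀} dist^symm_{X_t}(A_λ(t), A_{λ₀}(t)) = 0 for every λ₀ ∈ Λ. -/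
open Filter Topology Set
open scoped ENNReal

/-- Under Assumption A with continuous process maps and compact sections `B(t)`, `t ≤ t₀`: at a fixed time `t`, pullback equi-attraction implies continuity of `λ ↦ A_λ(t)` w.r.t. the symmetric Hausdorff distance. -/
theorem equi_attraction_implies_continuity
    (X : ℝ → Type*) [∀ t, MetricSpace (X t)]
    (Λ : Type*) [MetricSpace Λ] [CompleteSpace Λ]
    (U : Λ → (t τ : ℝ) → X τ → X t)
    (hUid : ∀ (lam : Λ) (τ : ℝ) (x : X τ), U lam τ τ x = x)
    (hUcomp : ∀ (lam : Λ) (t s τ : ℝ), τ ≤ s → s ≤ t →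
      ∀ x : X τ, U lam t s (U lam s τ x) = U lam t τ x)
    -- (L1) attractors: nonempty, compact, invariant
    (A : Λ → (t : ℝ) → Set (X t))
    (hAne : ∀ lam t, (A lam t).Nonempty)
    (hAcpt : ∀ lam t, IsCompact (A lam t))
    (hAinv : ∀ (lam : Λ) (t τ : ℝ), τ ≤ t → U lam t τ '' A lam τ = A lam t)
    -- (L2)
    (B : (t : ℝ) → Set (X t)) (t₀ : ℝ)
    (hBne : ∀ t, (B t).Nonempty)
    (hAB : ∀ (lam : Λ) (t : ℝ), t ≤ t₀ → A lam t ⊆ B t)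
    (hattr : ∀ (lam : Λ) (t : ℝ),
      Tendsto (fun τ : ℝ => hsd (U lam t τ '' B τ) (A lam t)) atBot (𝓝 0))
    -- (L3)
    (hL3 : ∀ (t s : ℝ), s ≤ min t t₀ → ∀ lam₀ : Λ,
      Tendsto (fun lam : Λ => ⨆ x ∈ B s, edist (U lam t s x) (U lam₀ t s x))
        (𝓝 lam₀) (𝓝 0))
    -- continuity of the process maps
    (hUcont : ∀ (lam : Λ) (t τ : ℝ), τ ≤ t → Continuous (U lam t τ))
    -- compactness of the sections of B
    (hBcpt : ∀ t : ℝ, t ≤ t₀ → IsCompact (B t))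
    (t : ℝ)
    -- pullback equi-attraction at time t
    (hequi : Tendsto (fun s : ℝ => ⨆ lam : Λ, hsd (U lam t s '' B s) (A lam t))
      atBot (𝓝 0)) :
    ∀ lam₀ : Λ,
      Tendsto (fun lam : Λ => hsds (A lam t) (A lam₀ t)) (𝓝 lam₀) (𝓝 0) := by
  intro lam₀
  rw [ENNReal.tendsto_nhds_zero]
  intro ε hε
  have hε2 : (0 : ℝ≥0∞) < ε / 2 := ENNReal.div_pos hε.ne' (by simp)
  rw [ENNReal.tendsto_nhds_zero] at hequi
  obtain ⟨s, hs1, hs2⟩ := ((hequi _ hε2).and (eventually_le_atBot (min t t₀))).exists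
  have hst : s ≤ t := hs2.trans (min_le_left _ _)
  have hst0 : s ≤ t₀ := hs2.trans (min_le_right _ _)
  have h3 := hL3 t s hs2 lam₀
  rw [ENNReal.tendsto_nhds_zero] at h3
  have key : ∀ l m : Λ, (∀ x ∈ B s, edist (U l t s x) (U m t s x) ≤ ε / 2) →
      hsd (A l t) (A m t) ≤ ε := by
    intro l m h
    refine iSup₂_le fun a ha => ?_
    rw [← hAinv l t s hst] at ha
    obtain ⟨b, hb, rfl⟩ := ha
    have hbB := hAB l s hst0 hb
    have h1 : EMetric.infEdist (U m t s b) (A m t) ≤ ε / 2 := by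
      refine le_trans ?_ ((le_iSup (fun lam : Λ => hsd (U lam t s '' B s) (A lam t)) m).trans hs1)
      exact le_iSup₂ (f := fun x (_ : x ∈ U m t s '' B s) => EMetric.infEdist x (A m t))
        (U m t s b) (mem_image_of_mem _ hbB)
    calc EMetric.infEdist (U l t s b) (A m t)
        ≤ EMetric.infEdist (U m t s b) (A m t) + edist (U l t s b) (U m t s b) :=
          Metric.infEDist_le_infEDist_add_edist
      _ ≤ ε / 2 + ε / 2 := add_le_add h1 (h b hbB)
      _ = ε := ENNReal.add_halves ε
  filter_upwards [h3 _ hε2] with lam hlam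
  have h : ∀ x ∈ B s, edist (U lam t s x) (U lam₀ t s x) ≤ ε / 2 := fun x hx =>
    (le_iSup₂ (f := fun x (_ : x ∈ B s) => edist (U lam t s x) (U lam₀ t s x)) x hx).trans hlam
  exact max_le (key _ _ h) (key _ _ fun x hx => by rw [edist_comm]; exact h x hx)
end

section
/- Under Assumption A, with each map U_λ(t,τ): X_τ → X_t continuous, B(t) compact in X_t for all t ≤ t₀, and the metric space Λ compact, suppose there is a function γ: ℝ → ℝ with γ(t) ≤ min{t,t₀} such that ⋃_{λ∈Λ} U_λ(t,s)B(s) ⊆ B(t) for all s ≤ γ(t) and t ∈ ℝ. Fix t ∈ ℝ. If the mapping λ ↦ A_λ(t) is continuous on Λ with respect to the symmetric Hausdorff distance, then the pullback equi-attraction holds at time t: lim_{s→−∞} sup_{λ∈Λ} dist_{X_t}(U_λ(t,s)B(s), A_λ(t)) = 0. -/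
open Filter Topology Set
open scoped ENNReal

theorem infEdist_le_add_hsd {α : Type*} [PseudoEMetricSpace α] (y : α) (C D : Set α) :
    EMetric.infEdist y C ≤ EMetric.infEdist y D + hsd D C := by
  by_cases h : EMetric.infEdist y D = ⊤
  · simp [h]
  refine ENNReal.le_of_forall_pos_le_add fun ε hε _ => ?_
  have hlt : EMetric.infEdist y D < EMetric.infEdist y D + ε :=
    ENNReal.lt_add_right h (by exact_mod_cast hε.ne')
  obtain ⟨d, hd, hyd⟩ := EMetric.infEdist_lt_iff.1 hlt
  have h1 : EMetric.infEdist y C ≤ EMetric.infEdist d C + edist y d :=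
    EMetric.infEdist_le_infEdist_add_edist
  have h2 : EMetric.infEdist d C ≤ hsd D C :=
    le_iSup₂ (f := fun x (_ : x ∈ D) => EMetric.infEdist x C) d hd
  calc _ ≤ _ := h1
    _ ≤ hsd D C + (EMetric.infEdist y D + ε) := add_le_add h2 hyd.le
    _ = _ := by ring

/-- Under Assumption A with continuous process maps, compact sections `B(t)`, `t ≤ t₀`, compact `Λ`, and a backward absorption property of the family `B`: at a fixed time `t`, continuity of `λ ↦ A_λ(t)` implies pullback equi-attraction. -/
theorem continuity_implies_equi_attraction
    (X : ℝ → Type*) [∀ t, MetricSpace (X t)]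
    (Λ : Type*) [MetricSpace Λ] [CompleteSpace Λ] [CompactSpace Λ]
    (U : Λ → (t τ : ℝ) → X τ → X t)
    (hUid : ∀ (lam : Λ) (τ : ℝ) (x : X τ), U lam τ τ x = x)
    (hUcomp : ∀ (lam : Λ) (t s τ : ℝ), τ ≤ s → s ≤ t →
      ∀ x : X τ, U lam t s (U lam s τ x) = U lam t τ x)
    -- (L1) attractors: nonempty, compact, invariant
    (A : Λ → (t : ℝ) → Set (X t))
    (hAne : ∀ lam t, (A lam t).Nonempty)
    (hAcpt : ∀ lam t, IsCompact (A lam t))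
    (hAinv : ∀ (lam : Λ) (t τ : ℝ), τ ≤ t → U lam t τ '' A lam τ = A lam t)
    -- (L2)
    (B : (t : ℝ) → Set (X t)) (t₀ : ℝ)
    (hBne : ∀ t, (B t).Nonempty)
    (hAB : ∀ (lam : Λ) (t : ℝ), t ≤ t₀ → A lam t ⊆ B t)
    (hattr : ∀ (lam : Λ) (t : ℝ),
      Tendsto (fun τ : ℝ => hsd (U lam t τ '' B τ) (A lam t)) atBot (𝓝 0))
    -- (L3)
    (hL3 : ∀ (t s : ℝ), s ≤ min t t₀ → ∀ lam₀ : Λ,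
      Tendsto (fun lam : Λ => ⨆ x ∈ B s, edist (U lam t s x) (U lam₀ t s x))
        (𝓝 lam₀) (𝓝 0))
    -- continuity of the process maps
    (hUcont : ∀ (lam : Λ) (t τ : ℝ), τ ≤ t → Continuous (U lam t τ))
    -- compactness of the sections of B
    (hBcpt : ∀ t : ℝ, t ≤ t₀ → IsCompact (B t))
    (γfun : ℝ → ℝ) (hγ : ∀ r : ℝ, γfun r ≤ min r t₀)
    (habs : ∀ (r s : ℝ), s ≤ γfun r → ∀ lam : Λ, U lam r s '' B s ⊆ B r)
    (t : ℝ)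
    -- continuity of the attractor map at time t
    (hcont : ∀ lam₀ : Λ,
      Tendsto (fun lam : Λ => hsds (A lam t) (A lam₀ t)) (𝓝 lam₀) (𝓝 0)) :
    Tendsto (fun s : ℝ => ⨆ lam : Λ, hsd (U lam t s '' B s) (A lam t))
      atBot (𝓝 0) := by
  rw [ENNReal.tendsto_nhds_zero]
  intro ε hε
  have key : ∀ᶠ s in (atBot : Filter ℝ), ∀ lam ∈ (univ : Set Λ),
      hsd (U lam t s '' B s) (A lam t) ≤ ε := by
    refine isCompact_univ.induction_on
      (p := fun S => ∀ᶠ s in (atBot : Filter ℝ), ∀ lam ∈ S,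
        hsd (U lam t s '' B s) (A lam t) ≤ ε) ?_ ?_ ?_ ?_
    · simp
    · intro S T hST hT
      exact hT.mono fun s hs lam hl => hs lam (hST hl)
    · intro S T hS hT
      filter_upwards [hS, hT] with s h1 h2 lam hl
      exact hl.elim (h1 lam) (h2 lam)
    · intro l0 _
      have hε3 : 0 < ε / 3 := ENNReal.div_pos hε.ne' (by simp)
      obtain ⟨s0, h0, hs0⟩ := ((ENNReal.tendsto_nhds_zero.1 (hattr l0 t) _ hε3).and
        (eventually_le_atBot (min t t₀))).exists
      have e1 := ENNReal.tendsto_nhds_zero.1 (hL3 t s0 hs0 l0) _ hε3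
      have e2 := ENNReal.tendsto_nhds_zero.1 (hcont l0) _ hε3
      refine ⟨_, mem_nhdsWithin_of_mem_nhds (e1.and e2), ?_⟩
      filter_upwards [eventually_le_atBot (γfun s0)] with s hs lam hl
      obtain ⟨h1, h2⟩ := hl
      refine iSup₂_le ?_
      rintro _ ⟨x, hx, rfl⟩
      have hss : s ≤ s0 := hs.trans ((hγ s0).trans (min_le_left _ _))
      rw [← hUcomp lam t s0 s hss (hs0.trans (min_le_left _ _)) x]
      have hy : U lam s0 s x ∈ B s0 := habs s0 s hs lam ⟨x, hx, rfl⟩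
      generalize U lam s0 s x = y at hy
      have g1 : edist (U lam t s0 y) (U l0 t s0 y) ≤ ε / 3 :=
        (le_iSup₂ (f := fun x (_ : x ∈ B s0) => edist (U lam t s0 x) (U l0 t s0 x)) y hy).trans h1
      have g2 : EMetric.infEdist (U l0 t s0 y) (A l0 t) ≤ ε / 3 :=
        (le_iSup₂ (f := fun x (_ : x ∈ U l0 t s0 '' B s0) => EMetric.infEdist x (A l0 t)) _
          ⟨y, hy, rfl⟩).trans h0
      have g3 : hsd (A l0 t) (A lam t) ≤ ε / 3 := (le_max_right _ _).trans h2
      calc EMetric.infEdist (U lam t s0 y) (A lam t)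
          ≤ EMetric.infEdist (U l0 t s0 y) (A lam t) + edist (U lam t s0 y) (U l0 t s0 y) :=
            EMetric.infEdist_le_infEdist_add_edist
        _ ≤ (EMetric.infEdist (U l0 t s0 y) (A l0 t) + hsd (A l0 t) (A lam t))
            + edist (U lam t s0 y) (U l0 t s0 y) :=
            add_le_add (infEdist_le_add_hsd _ _ _) le_rfl
        _ ≤ ε / 3 + ε / 3 + ε / 3 := add_le_add (add_le_add g2 g3) g1
        _ = ε := ENNReal.add_thirds ε
  filter_upwards [key] with s hs
  exact iSup_le fun lam => hs lam (mem_univ _)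
end

section
/- Let U be a process on a family {X_t}_{t∈ℝ} of normed real vector spaces, let B = {B(t)}_{t∈ℝ}, D = {D(t)}_{t∈ℝ} and E = {E(t)}_{t∈ℝ} be families of nonempty subsets with E(t), B(t) ⊆ X_t, and let β > 0 and, for each t ∈ ℝ, constants C(t) > 0 and τ_t > 0 be such that dist_{X_t}(U(t,t−τ)B(t−τ), E(t)) ≤ C(t)e^{−βτ} for all τ ≥ τ_t. Suppose there is e₀ > 0 such that U(t,t−τ)D(t−τ) ⊆ B(t) for all τ ≥ e₀ and t ∈ ℝ. Then dist_{X_t}(U(t,t−τ)D(t−τ), E(t)) ≤ C(t)e^{β e₀} e^{−βτ} for all t ∈ ℝ and all τ ≥ e₀ + τ_t; in particular E pullback attracts D at an exponential rate. -/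
open Filter Topology Set
open scoped ENNReal

/-- A family that exponentially pullback attracts a uniformly absorbing family `B`
exponentially pullback attracts every family `D` absorbed by `B`. -/
theorem exponential_attraction_of_absorbed_family
    (X : ℝ → Type*) [∀ t, NormedAddCommGroup (X t)] [∀ t, NormedSpace ℝ (X t)]
    (U : (t τ : ℝ) → X τ → X t)
    (hUid : ∀ (τ : ℝ) (x : X τ), U τ τ x = x)
    (hUcomp : ∀ (t s τ : ℝ), τ ≤ s → s ≤ t →
      ∀ x : X τ, U t s (U s τ x) = U t τ x)
    (B D E : (t : ℝ) → Set (X t))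
    (hBne : ∀ t, (B t).Nonempty) (hDne : ∀ t, (D t).Nonempty) (hEne : ∀ t, (E t).Nonempty)
    (β : ℝ) (hβ : 0 < β) (C τt : ℝ → ℝ) (hC : ∀ t, 0 < C t) (hτt : ∀ t, 0 < τt t)
    (hattr : ∀ (t τ : ℝ), τt t ≤ τ →
      hsd (U t (t - τ) '' B (t - τ)) (E t) ≤ ENNReal.ofReal (C t * Real.exp (-β * τ)))
    (e₀ : ℝ) (he₀ : 0 < e₀)
    (habs : ∀ (t τ : ℝ), e₀ ≤ τ → U t (t - τ) '' D (t - τ) ⊆ B t) :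
    ∀ (t τ : ℝ), e₀ + τt t ≤ τ →
      hsd (U t (t - τ) '' D (t - τ)) (E t) ≤
        ENNReal.ofReal (C t * Real.exp (β * e₀) * Real.exp (-β * τ)) := by
  intro t τ hτ
  have hpos := hτt t
  have h1 := hattr t (τ - e₀) (by linarith)
  have hexp : C t * Real.exp (-β * (τ - e₀))
      = C t * Real.exp (β * e₀) * Real.exp (-β * τ) := by
    rw [mul_assoc, ← Real.exp_add]
    congr 2
    ring
  rw [hexp] at h1
  refine le_trans ?_ h1
  have hsub : U t (t - τ) '' D (t - τ) ⊆ U t (t - (τ - e₀)) '' B (t - (τ - e₀)) := by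
    have h2 := habs (t - (τ - e₀)) e₀ le_rfl
    have h3 : t - (τ - e₀) - e₀ = t - τ := by ring
    rw [h3] at h2
    rintro _ ⟨x, hx, rfl⟩
    exact ⟨_, h2 ⟨x, hx, rfl⟩, hUcomp _ _ _ (by linarith) (by linarith) x⟩
  exact biSup_mono hsub
end

section
/- Let U be a process on a family {X_t}_{t∈ℝ} of normed real vector spaces and let D₀ = {D₀(t)}, B = {B(t)}, E = {E(t)} be families of nonempty subsets of X_t. Let 0 < R₀ < 𝓡 and suppose: (i) B(t) is contained in the closed ball of radius R₀ of X_t and D₀(t) in the closed ball of radius 𝓡 of X_t for all t; (ii) there are κ, τ₁, C₀ > 0 with dist_{X_t}(U(t,t−τ)D₀(t−τ), B(t)) ≤ C₀e^{−κτ} for all t ∈ ℝ, τ ≥ τ₁; (iii) there are C₁, γ > 0 with ‖U(t,t−τ)x − U(t,t−τ)y‖_{X_t} ≤ C₁e^{γτ}‖x−y‖_{X_{t−τ}} for all x,y in the closed ball of radius 𝓡 of X_{t−τ}, all τ ≥ 0 and t ∈ ℝ; (iv) there are β > 0 and, for each t, constants C(t), τ_t > 0 with dist_{X_t}(U(t,t−τ)B(t−τ),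 E(t)) ≤ C(t)e^{−βτ} for τ ≥ τ_t; (v) setting θ = κ/(2(γ+κ)), there is e₁ > τ₁ such that U(t−τθ, t−τ)D₀(t−τ) ⊆ D₀(t−τθ) for all τ ≥ (1−θ)⁻¹e₁ and t ∈ ℝ. Then, with β' = min{κ/2, κβ/(2(γ+κ))}, one has dist_{X_t}(U(t,t−τ)D₀(t−τ), E(t)) ≤ (C₁C₀ + C(t))e^{−β'τ} for all t ∈ ℝ and all τ ≥ max{θ⁻¹τ_t, (1−θ)⁻¹e₁}. -/
open Filter Topology Set
open scoped ENNReal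

/-- The key estimate (14.10): a family `E` that exponentially pullback attracts `B`
exponentially pullback attracts the absorbing family `D₀`, with the stated rate `β'`
and constant, where `θ = κ/(2(γ+κ))` and `β' = min{κ/2, κβ/(2(γ+κ))}`. -/
theorem exponential_attraction_of_D0
    (X : ℝ → Type*) [∀ t, NormedAddCommGroup (X t)] [∀ t, NormedSpace ℝ (X t)]
    (U : (t τ : ℝ) → X τ → X t)
    (hUid : ∀ (τ : ℝ) (x : X τ), U τ τ x = x)
    (hUcomp : ∀ (t s τ : ℝ), τ ≤ s → s ≤ t →
      ∀ x : X τ, U t s (U s τ x) = U t τ x)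
    (D₀ B E : (t : ℝ) → Set (X t))
    (hD₀ne : ∀ t, (D₀ t).Nonempty) (hBne : ∀ t, (B t).Nonempty) (hEne : ∀ t, (E t).Nonempty)
    (R₀ 𝓡 : ℝ) (hR₀ : 0 < R₀) (hR : R₀ < 𝓡)
    -- (i)
    (hBball : ∀ t, B t ⊆ Metric.closedBall (0 : X t) R₀)
    (hD₀ball : ∀ t, D₀ t ⊆ Metric.closedBall (0 : X t) 𝓡)
    -- (ii)
    (κ τ₁ C₀ : ℝ) (hκ : 0 < κ) (hτ₁ : 0 < τ₁) (hC₀ : 0 < C₀)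
    (hD₀B : ∀ (t τ : ℝ), τ₁ ≤ τ →
      hsd (U t (t - τ) '' D₀ (t - τ)) (B t) ≤ ENNReal.ofReal (C₀ * Real.exp (-κ * τ)))
    -- (iii)
    (C₁ γ : ℝ) (hC₁ : 0 < C₁) (hγ : 0 < γ)
    (hLip : ∀ (t τ : ℝ), 0 ≤ τ →
      ∀ x ∈ Metric.closedBall (0 : X (t - τ)) 𝓡, ∀ y ∈ Metric.closedBall (0 : X (t - τ)) 𝓡,
        ‖U t (t - τ) x - U t (t - τ) y‖ ≤ C₁ * Real.exp (γ * τ) * ‖x - y‖)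
    -- (iv)
    (β : ℝ) (hβ : 0 < β) (C τt : ℝ → ℝ) (hC : ∀ t, 0 < C t) (hτt : ∀ t, 0 < τt t)
    (hattr : ∀ (t τ : ℝ), τt t ≤ τ →
      hsd (U t (t - τ) '' B (t - τ)) (E t) ≤ ENNReal.ofReal (C t * Real.exp (-β * τ)))
    -- (v), with θ = κ/(2(γ+κ))
    (e₁ : ℝ) (he₁ : τ₁ < e₁)
    (habs : ∀ (t τ : ℝ), (1 - κ / (2 * (γ + κ)))⁻¹ * e₁ ≤ τ →
      U (t - τ * (κ / (2 * (γ + κ)))) (t - τ) '' D₀ (t - τ) ⊆ D₀ (t - τ * (κ / (2 * (γ + κ))))) :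
    ∀ (t τ : ℝ),
      max ((κ / (2 * (γ + κ)))⁻¹ * τt t) ((1 - κ / (2 * (γ + κ)))⁻¹ * e₁) ≤ τ →
      hsd (U t (t - τ) '' D₀ (t - τ)) (E t) ≤
        ENNReal.ofReal ((C₁ * C₀ + C t) * Real.exp (-(min (κ / 2) (κ * β / (2 * (γ + κ)))) * τ)) := by
  intro t τ hτ
  obtain ⟨h1, h2⟩ := max_le_iff.mp hτ
  have hgk : 0 < γ + κ := by positivity
  have hD₀B' : ∀ s r : ℝ, τ₁ ≤ s - r →
      hsd (U s r '' D₀ r) (B s) ≤ ENNReal.ofReal (C₀ * Real.exp (-κ * (s - r))) := by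
    intro s r h
    have h' := hD₀B s (s - r) h
    rw [sub_sub_cancel] at h'
    exact h'
  have hab := habs t τ h2
  have hθk : (γ + κ) * (κ / (2 * (γ + κ))) = κ / 2 := by field_simp
  have hβθ : κ * β / (2 * (γ + κ)) = β * (κ / (2 * (γ + κ))) := by ring
  rw [hβθ]
  have hθ0 : 0 < κ / (2 * (γ + κ)) := by positivity
  have hθ1 : κ / (2 * (γ + κ)) < 1 := by
    rw [div_lt_one (by positivity)]; linarith
  generalize κ / (2 * (γ + κ)) = θ at *
  have h1' : τt t ≤ τ * θ := by
    rw [inv_mul_le_iff₀ hθ0] at h1; linarith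
  have h2' : e₁ ≤ (1 - θ) * τ := by
    rwa [inv_mul_le_iff₀ (by linarith)] at h2
  have hτθ : 0 < τ * θ := (hτt t).trans_le h1'
  have hτ0 : 0 < τ := pos_of_mul_pos_left hτθ hθ0.le
  unfold hsd
  refine iSup₂_le ?_
  rintro _ ⟨x, hx, rfl⟩
  rw [← hUcomp t (t - τ * θ) (t - τ) (by nlinarith) (by linarith) x]
  have hz : U (t - τ * θ) (t - τ) x ∈ D₀ (t - τ * θ) := hab ⟨x, hx, rfl⟩
  have hzB : EMetric.infEdist (U (t - τ * θ) (t - τ) x) (B (t - τ * θ)) ≤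
      ENNReal.ofReal (C₀ * Real.exp (-κ * ((t - τ * θ) - (t - τ)))) :=
    (le_iSup₂_of_le (f := fun z (_ : z ∈ U (t - τ * θ) (t - τ) '' D₀ (t - τ)) =>
      EMetric.infEdist z (B (t - τ * θ))) _ ⟨x, hx, rfl⟩ le_rfl).trans
      (hD₀B' (t - τ * θ) (t - τ) (by linarith))
  generalize U (t - τ * θ) (t - τ) x = z at hz hzB
  have key : ∀ y ∈ B (t - τ * θ), EMetric.infEdist (U t (t - τ * θ) z) (E t) ≤
      ENNReal.ofReal (C₁ * Real.exp (γ * (τ * θ))) * edist z y +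
        ENNReal.ofReal (C t * Real.exp (-β * (τ * θ))) := by
    intro y hy
    have hl := hLip t (τ * θ) hτθ.le z (hD₀ball _ hz) y
      (Metric.closedBall_subset_closedBall hR.le (hBball _ hy))
    have he : EMetric.infEdist (U t (t - τ * θ) y) (E t) ≤
        ENNReal.ofReal (C t * Real.exp (-β * (τ * θ))) :=
      (le_iSup₂_of_le (f := fun z (_ : z ∈ U t (t - τ * θ) '' B (t - τ * θ)) =>
        EMetric.infEdist z (E t)) _ ⟨y, hy, rfl⟩ le_rfl).trans (hattr t (τ * θ) h1')
    refine (Metric.infEDist_le_edist_add_infEDist (y := U t (t - τ * θ) y)).trans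
      (add_le_add ?_ he)
    rw [edist_dist, edist_dist, dist_eq_norm, dist_eq_norm, ← ENNReal.ofReal_mul (by positivity)]
    exact ENNReal.ofReal_le_ofReal hl
  have key2 : EMetric.infEdist (U t (t - τ * θ) z) (E t) ≤
      ENNReal.ofReal (C₁ * Real.exp (γ * (τ * θ))) * EMetric.infEdist z (B (t - τ * θ)) +
        ENNReal.ofReal (C t * Real.exp (-β * (τ * θ))) := by
    have hpos : 0 < C₁ * Real.exp (γ * (τ * θ)) := by positivity
    have e : EMetric.infEdist z (B (t - τ * θ)) = ⨅ y : B (t - τ * θ), edist z y := by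
      rw [iInf_subtype]; rfl
    rw [e, ENNReal.mul_iInf_of_ne (by simpa using hpos) ENNReal.ofReal_ne_top, ENNReal.iInf_add]
    exact le_iInf fun y => key y y.2
  refine key2.trans ((add_le_add_left (mul_le_mul_right hzB _) _).trans ?_)
  rw [← ENNReal.ofReal_mul (by positivity), ← ENNReal.ofReal_add (by positivity)
    (mul_nonneg (hC t).le (Real.exp_pos _).le)]
  apply ENNReal.ofReal_le_ofReal
  have e1 : C₁ * Real.exp (γ * (τ * θ)) * (C₀ * Real.exp (-κ * (t - τ * θ - (t - τ)))) =
      C₁ * C₀ * Real.exp (-(κ / 2) * τ) := by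
    have : -(κ / 2) * τ = γ * (τ * θ) + -κ * (t - τ * θ - (t - τ)) := by
      linear_combination (-τ) * hθk
    rw [this, Real.exp_add]; ring
  rw [e1, add_mul]
  have hCt := (hC t).le
  have m1 := mul_le_mul_of_nonneg_right (min_le_left (κ / 2) (β * θ)) hτ0.le
  have m2 := mul_le_mul_of_nonneg_right (min_le_right (κ / 2) (β * θ)) hτ0.le
  refine add_le_add (mul_le_mul_of_nonneg_left (Real.exp_le_exp.2 ?_) (by positivity))
    (mul_le_mul_of_nonneg_left (Real.exp_le_exp.2 ?_) hCt)
  · linarith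
  · linarith
end

section
/- Let {X_n}_{n∈ℤ} be a family of normed real vector spaces and U a discrete process on it. Let R₀ > 0 and B(n) ⊆ X_n be nonempty subsets contained in the closed ball of radius R₀ of X_n with U(m,n)B(n) ⊆ B(m) for all n ≤ m ∈ ℤ. Let Z be a Banach space with a compact seminorm n_Z, let n_* ∈ ℤ, η ∈ (0,1/2), L > 0, and for each n ≤ n_* let K_n : B(n−1) → Z satisfy, for all x,y ∈ B(n−1): ‖U(n,n−1)x − U(n,n−1)y‖_{X_n} ≤ η‖x−y‖_{X_{n−1}} + n_Z(K_n x − K_n y) and ‖K_n x − K_n y‖_Z ≤ L‖x−y‖_{X_{n−1}}. Then for every n ≤ n_* and every k ≥ 1, the set U(n,n−k)B(n−k) can be covered by at most [m_Z(2L/η)]^k closed subsets of X_n, each of diameter ≤ 2(2η)^k R₀. -/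
open Filter Topology Set
open scoped ENNReal

/-- A seminorm `p` on a Banach space is compact if every bounded sequence has a
subsequence that is Cauchy with respect to `p`. -/
def IsCompactSeminorm {Z : Type*} [NormedAddCommGroup Z] [NormedSpace ℝ Z]
    (p : Seminorm ℝ Z) : Prop :=
  ∀ u : ℕ → Z, (∃ C : ℝ, ∀ n, ‖u n‖ ≤ C) →
    ∃ φ : ℕ → ℕ, StrictMono φ ∧
      ∀ ε : ℝ, 0 < ε → ∃ N : ℕ, ∀ m ≥ N, ∀ n ≥ N, p (u (φ m) - u (φ n)) < ε

/-- `mZ p R` is the maximal number of elements of the closed ball of radius `R`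
that are pairwise more than `1` apart in the seminorm `p`. -/
noncomputable def mZ {Z : Type*} [NormedAddCommGroup Z] [NormedSpace ℝ Z]
    (p : Seminorm ℝ Z) (R : ℝ) : ℕ :=
  sSup {n : ℕ | ∃ f : Fin n → Z, (∀ i, ‖f i‖ ≤ R) ∧
    ∀ i j, i ≠ j → 1 < p (f i - f j)}

theorem qs_net {Z : Type*} [NormedAddCommGroup Z] [NormedSpace ℝ Z]
    (p : Seminorm ℝ Z) (hp : IsCompactSeminorm p) (R : ℝ) :
    ∃ F : Finset Z, ∀ z : Z, ‖z‖ ≤ R → ∃ y ∈ F, p (y - z) < 1 / 2 := by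
  by_contra H
  push Not at H
  obtain ⟨f, hf1, hf2⟩ := exists_seq_of_forall_finset_exists (fun z : Z => ‖z‖ ≤ R)
    (fun y z => 1 / 2 ≤ p (y - z)) (fun s _ => H s)
  obtain ⟨φ, hφ, hc⟩ := hp f ⟨R, hf1⟩
  obtain ⟨N, hN⟩ := hc (1 / 2) (by norm_num)
  have h1 := hN N le_rfl (N + 1) (Nat.le_succ N)
  have h2 := hf2 (φ N) (φ (N + 1)) (hφ (Nat.lt_succ_self N))
  linarith

theorem qs_bdd {Z : Type*} [NormedAddCommGroup Z] [NormedSpace ℝ Z]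
    (p : Seminorm ℝ Z) (hp : IsCompactSeminorm p) (R : ℝ) :
    BddAbove {n : ℕ | ∃ f : Fin n → Z, (∀ i, ‖f i‖ ≤ R) ∧
      ∀ i j, i ≠ j → 1 < p (f i - f j)} := by
  obtain ⟨F, hF⟩ := qs_net p hp R
  refine ⟨F.card, ?_⟩
  rintro n ⟨f, hf, hs⟩
  choose g hg hgp using fun i => hF (f i) (hf i)
  have hinj : Function.Injective g := by
    intro i j hij
    by_contra hne
    have h1 := hs i j hne
    have h2 := hgp i
    have h3 := hgp j
    rw [← hij] at h3
    have h4 : p (f i - f j) ≤ p (g i - f j) + p (g i - f i) := by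
      have : f i - f j = (g i - f j) - (g i - f i) := by abel
      rw [this]
      exact map_sub_le_add p _ _
    linarith
  have := Finset.card_le_card_of_injOn (s := Finset.univ) (t := F) g (fun i _ => hg i)
    (fun i _ j _ h => hinj h)
  simpa using this

theorem qs_step {Z : Type*} [NormedAddCommGroup Z] [NormedSpace ℝ Z]
    (p : Seminorm ℝ Z) (hp : IsCompactSeminorm p) {α : Type*} (K : α → Z) (A : Set α)
    (η L d : ℝ) (hη : 0 < η) (hd : 0 < d)
    (hK : ∀ x ∈ A, ∀ y ∈ A, ‖K x - K y‖ ≤ L * d) :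
    ∃ F : Finset α, F.card ≤ mZ p (2 * L / η) ∧
      ∀ x ∈ A, ∃ y ∈ F, p (K x - K y) ≤ η * d / 2 := by
  classical
  rcases A.eq_empty_or_nonempty with rfl | ⟨x₀, hx₀⟩
  · exact ⟨∅, by simp, by simp⟩
  by_contra H
  push Not at H
  have hc : 0 < η * d / 2 := by positivity
  have key : ∀ F : Finset α, ↑F ⊆ A →
      (∀ x ∈ F, ∀ y ∈ F, x ≠ y → η * d / 2 < p (K x - K y)) →
      F.card ≤ mZ p (2 * L / η) := by
    intro F hFA hsep
    refine le_csSup (qs_bdd p hp _) ?_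
    let e := F.equivFin.symm
    refine ⟨fun i => (η * d / 2)⁻¹ • (K (e i) - K x₀), ?_, ?_⟩
    · intro i
      rw [norm_smul, Real.norm_of_nonneg (by positivity)]
      have := hK (e i) (hFA (e i).2) x₀ hx₀
      calc _ ≤ (η * d / 2)⁻¹ * (L * d) := by gcongr
        _ = 2 * L / η := by field_simp
    · intro i j hij
      have h := hsep (e i) (e i).2 (e j) (e j).2
        (fun h => hij (e.injective (Subtype.ext h)))
      rw [← smul_sub, map_smul_eq_mul, Real.norm_of_nonneg (by positivity),
        sub_sub_sub_cancel_right]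
      rwa [inv_mul_eq_div, one_lt_div hc]
  have all : ∀ n : ℕ, ∃ F : Finset α, F.card = n ∧ ↑F ⊆ A ∧
      (∀ x ∈ F, ∀ y ∈ F, x ≠ y → η * d / 2 < p (K x - K y)) := by
    intro n
    induction n with
    | zero => exact ⟨∅, by simp⟩
    | succ n ih =>
      obtain ⟨F, hFn, hFA, hsep⟩ := ih
      obtain ⟨x, hxA, hx⟩ := H F (key F hFA hsep)
      have hxF : x ∉ F := by
        intro h
        have := hx x h
        simp at this
        linarith
      refine ⟨insert x F, by rw [Finset.card_insert_of_notMem hxF, hFn], ?_, ?_⟩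
      · rw [Finset.coe_insert]
        exact Set.insert_subset hxA hFA
      · intro a ha b hb hab
        rw [Finset.mem_insert] at ha hb
        rcases ha with rfl | ha <;> rcases hb with rfl | hb
        · exact absurd rfl hab
        · exact hx b hb
        · rw [map_sub_rev]; exact hx a ha
        · exact hsep a ha b hb hab
  obtain ⟨F, hFn, hFA, hsep⟩ := all (mZ p (2 * L / η) + 1)
  have := key F hFA hsep
  omega

/-- The quasi-stability covering estimate (14.15): for `n ≤ n_*` and `k ≥ 1`, the set
`U(n,n-k)B(n-k)` can be covered by at most `[m_Z(2L/η)]^k` closed subsets of `X n`,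
each of diameter `≤ 2(2η)^k R₀`. -/
theorem quasi_stability_covering_estimate
    (X : ℤ → Type*) [∀ n, NormedAddCommGroup (X n)] [∀ n, NormedSpace ℝ (X n)]
    (U : (m n : ℤ) → X n → X m)
    (hUid : ∀ (n : ℤ) (x : X n), U n n x = x)
    (hUcomp : ∀ (m k n : ℤ), n ≤ k → k ≤ m → ∀ x : X n, U m k (U k n x) = U m n x)
    (R₀ : ℝ) (hR₀ : 0 < R₀)
    (B : (n : ℤ) → Set (X n)) (hBne : ∀ n, (B n).Nonempty)
    (hBball : ∀ n, B n ⊆ Metric.closedBall (0 : X n) R₀)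
    (hBinv : ∀ (m n : ℤ), n ≤ m → U m n '' B n ⊆ B m)
    (Z : Type*) [NormedAddCommGroup Z] [NormedSpace ℝ Z] [CompleteSpace Z]
    (nZ : Seminorm ℝ Z) (hnZ : IsCompactSeminorm nZ)
    (nstar : ℤ) (η L : ℝ) (hη₀ : 0 < η) (hη₁ : η < 1 / 2) (hL : 0 < L)
    (K : (n : ℤ) → X (n - 1) → Z)
    (hQS : ∀ n : ℤ, n ≤ nstar → ∀ x ∈ B (n - 1), ∀ y ∈ B (n - 1),
      ‖U n (n - 1) x - U n (n - 1) y‖ ≤ η * ‖x - y‖ + nZ (K n x - K n y))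
    (hKLip : ∀ n : ℤ, n ≤ nstar → ∀ x ∈ B (n - 1), ∀ y ∈ B (n - 1),
      ‖K n x - K n y‖ ≤ L * ‖x - y‖) :
    ∀ n : ℤ, n ≤ nstar → ∀ k : ℕ, 1 ≤ k →
      ∃ 𝒞 : Finset (Set (X n)), 𝒞.card ≤ (mZ nZ (2 * L / η)) ^ k ∧
        (∀ s ∈ 𝒞, IsClosed s ∧ EMetric.diam s ≤ ENNReal.ofReal (2 * (2 * η) ^ k * R₀)) ∧
        U n (n - (k : ℤ)) '' B (n - (k : ℤ)) ⊆ ⋃₀ ↑𝒞 := by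
  classical
  suffices H : ∀ (k : ℕ) (n m : ℤ), n ≤ nstar → n = m + k →
      ∃ 𝒞 : Finset (Set (X n)), 𝒞.card ≤ (mZ nZ (2 * L / η)) ^ k ∧
        (∀ s ∈ 𝒞, IsClosed s ∧ EMetric.diam s ≤ ENNReal.ofReal (2 * (2 * η) ^ k * R₀)) ∧
        U n m '' B m ⊆ ⋃₀ ↑𝒞 from
    fun n hn k _ => H k n (n - k) hn (by ring)
  intro k
  induction k with
  | zero =>
    intro n m hn hnm
    obtain rfl : n = m := by simpa using hnm
    refine ⟨{Metric.closedBall 0 R₀}, by simp, ?_, ?_⟩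
    · intro s hs
      rw [Finset.mem_singleton] at hs
      subst hs
      refine ⟨Metric.isClosed_closedBall, Metric.ediam_le ?_⟩
      intro x hx y hy
      rw [edist_dist]
      apply ENNReal.ofReal_le_ofReal
      have h1 := dist_triangle_right x y 0
      rw [Metric.mem_closedBall] at hx hy
      linarith
    · rintro _ ⟨x, hx, rfl⟩
      rw [hUid]
      simpa using hBball n hx
  | succ k ih =>
    intro n m hn hnm
    push_cast at hnm
    obtain ⟨𝒞, hcard, hdiam, hcov⟩ := ih (n - 1) m (by omega) (by omega)
    set d : ℝ := 2 * (2 * η) ^ k * R₀ with hd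
    have hd0 : 0 < d := by positivity
    set A : Set (X (n - 1)) → Set (X (n - 1)) := fun s => s ∩ B (n - 1) with hA
    have hAd : ∀ s ∈ 𝒞, ∀ x ∈ A s, ∀ y ∈ A s, ‖x - y‖ ≤ d := by
      intro s hs x hx y hy
      have h := (Metric.edist_le_ediam_of_mem hx.1 hy.1).trans (hdiam s hs).2
      rw [edist_dist, ENNReal.ofReal_le_ofReal_iff hd0.le, dist_eq_norm] at h
      exact h
    have hF : ∀ s : Set (X (n - 1)), ∃ F : Finset (X (n - 1)), s ∈ 𝒞 →
        (F.card ≤ mZ nZ (2 * L / η) ∧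
          ∀ x ∈ A s, ∃ y ∈ F, nZ (K n x - K n y) ≤ η * d / 2) := by
      intro s
      by_cases hs : s ∈ 𝒞
      · obtain ⟨F, hF⟩ := qs_step nZ hnZ (K n) (A s) η L d hη₀ hd0 (by
          intro x hx y hy
          refine (hKLip n hn x hx.2 y hy.2).trans ?_
          have := hAd s hs x hx y hy
          gcongr)
        exact ⟨F, fun _ => hF⟩
      · exact ⟨∅, fun h => absurd h hs⟩
    choose F hF using hF
    refine ⟨𝒞.biUnion fun s => (F s).image fun y =>
      closure (U n (n - 1) '' {x | x ∈ A s ∧ nZ (K n x - K n y) ≤ η * d / 2}), ?_, ?_, ?_⟩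
    · refine (Finset.card_biUnion_le_card_mul _ _ (mZ nZ (2 * L / η)) ?_).trans ?_
      · intro s hs
        exact Finset.card_image_le.trans (hF s hs).1
      · rw [pow_succ]
        exact Nat.mul_le_mul_right _ hcard
    · intro t ht
      simp only [Finset.mem_biUnion, Finset.mem_image] at ht
      obtain ⟨s, hs, y, hy, rfl⟩ := ht
      refine ⟨isClosed_closure, ?_⟩
      refine (Metric.ediam_closure _).le.trans (Metric.ediam_le ?_)
      rintro _ ⟨a, ⟨haA, ha⟩, rfl⟩ _ ⟨b, ⟨hbA, hb⟩, rfl⟩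
      rw [edist_dist, dist_eq_norm]
      apply ENNReal.ofReal_le_ofReal
      have h1 := hQS n hn a haA.2 b hbA.2
      have h2 : nZ (K n a - K n b) ≤ nZ (K n a - K n y) + nZ (K n b - K n y) := by
        rw [← sub_sub_sub_cancel_right (K n a) (K n b) (K n y)]
        exact map_sub_le_add nZ _ _
      have h3 : η * ‖a - b‖ ≤ η * d := by
        have := hAd s hs a haA b hbA
        gcongr
      have h4 : 2 * (2 * η) ^ (k + 1) * R₀ = 2 * η * d := by rw [hd]; ring
      rw [h4]
      linarith
    · rintro _ ⟨x, hx, rfl⟩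
      have hx' : U (n - 1) m x ∈ U (n - 1) m '' B m := ⟨x, hx, rfl⟩
      obtain ⟨s, hs, hxs⟩ := hcov hx'
      have hs' : s ∈ 𝒞 := hs
      have hxB : U (n - 1) m x ∈ B (n - 1) := hBinv (n - 1) m (by omega) hx'
      obtain ⟨y, hy, hxy⟩ := (hF s hs').2 _ ⟨hxs, hxB⟩
      refine ⟨_, Finset.mem_coe.2 (Finset.mem_biUnion.2 ⟨s, hs',
        Finset.mem_image.2 ⟨y, hy, rfl⟩⟩), subset_closure ⟨U (n - 1) m x, ⟨⟨hxs, hxB⟩, hxy⟩, ?_⟩⟩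
      exact hUcomp n (n - 1) m (by omega) (by omega) x
end

section
/- Let X be a normed real vector space, let η ∈ (0,1/2), R₀ > 0, let m ≥ 2 be an integer, and let E ⊆ X be a nonempty set such that for every integer k ≥ 1, E can be covered by at most 2m^{k+1} closed subsets of X, each of diameter ≤ 4R₀(2η)^k. Then E is totally bounded and its fractal dimension satisfies dim_f(E,X) = limsup_{ε→0⁺} ln N(E,ε)/ln(1/ε) ≤ ln m / ln(1/(2η)), where N(E,ε) is the minimal number of closed subsets of X of diameter ≤ 2ε needed to cover E. -/
open Filter Topology Set
open scoped ENNReal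

/-- `coverNum E ε` is the minimal number of closed sets of diameter `≤ 2ε`
needed to cover `E` (junk value `0` if no finite such cover exists). -/
noncomputable def coverNum {α : Type*} [PseudoEMetricSpace α] (E : Set α) (ε : ℝ) : ℕ :=
  sInf {n : ℕ | ∃ 𝒞 : Finset (Set α), 𝒞.card ≤ n ∧
    (∀ s ∈ 𝒞, IsClosed s ∧ EMetric.diam s ≤ ENNReal.ofReal (2 * ε)) ∧ E ⊆ ⋃₀ ↑𝒞}

/-- The fractal dimension `dim_f(E) = limsup_{ε→0⁺} ln N(E,ε) / ln (1/ε)`. -/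
noncomputable def fractalDim {α : Type*} [PseudoEMetricSpace α] (E : Set α) : ℝ :=
  Filter.limsup (fun ε : ℝ => Real.log (coverNum E ε) / Real.log (1 / ε)) (nhdsWithin 0 (Set.Ioi 0))

/-- The fractal-dimension bound from estimates (14.28)–(14.30): if for every `k ≥ 1` the set
`E` can be covered by at most `2 m^{k+1}` closed sets of diameter `≤ 4R₀(2η)^k`, then `E`
is totally bounded and `dim_f(E) ≤ ln m / ln (1/(2η))`. -/
theorem fractal_dimension_bound
    (Xs : Type*) [NormedAddCommGroup Xs] [NormedSpace ℝ Xs]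
    (η R₀ : ℝ) (hη₀ : 0 < η) (hη₁ : η < 1 / 2) (hR₀ : 0 < R₀)
    (m : ℕ) (hm : 2 ≤ m)
    (E : Set Xs) (hEne : E.Nonempty)
    (hcover : ∀ k : ℕ, 1 ≤ k → ∃ 𝒞 : Finset (Set Xs),
      𝒞.card ≤ 2 * m ^ (k + 1) ∧
      (∀ s ∈ 𝒞, IsClosed s ∧ EMetric.diam s ≤ ENNReal.ofReal (4 * R₀ * (2 * η) ^ k)) ∧
      E ⊆ ⋃₀ ↑𝒞) :
    TotallyBounded E ∧ fractalDim E ≤ Real.log m / Real.log (1 / (2 * η)) := by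
  have hq0 : 0 < 2 * η := by linarith
  have hq1 : 2 * η < 1 := by linarith
  constructor
  · rw [Metric.totallyBounded_iff]
    intro ε hε
    obtain ⟨k, hk⟩ := exists_pow_lt_of_lt_one (show 0 < ε / (4 * R₀) by positivity) hq1
    obtain ⟨C, -, hC, hE⟩ := hcover (k + 1) (by omega)
    have hlt : 4 * R₀ * (2 * η) ^ (k + 1) < ε := by
      have h1 : (2 * η) ^ (k + 1) ≤ (2 * η) ^ k :=
        pow_le_pow_of_le_one hq0.le hq1.le (Nat.le_succ k)
      rw [lt_div_iff₀ (by positivity)] at hk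
      nlinarith
    classical
    refine ⟨(fun s : Set Xs => if h : s.Nonempty then h.some else 0) '' (C : Set (Set Xs)),
      C.finite_toSet.image _, ?_⟩
    intro x hx
    obtain ⟨s, hs, hxs⟩ := hE hx
    have hne : s.Nonempty := ⟨x, hxs⟩
    simp only [Set.mem_iUnion]
    refine ⟨_, ⟨s, hs, rfl⟩, ?_⟩
    simp only [hne, dif_pos]
    have h2 := (Metric.edist_le_ediam_of_mem hxs hne.some_mem).trans (hC s hs).2
    rw [edist_le_ofReal (by positivity)] at h2
    exact lt_of_le_of_lt h2 hlt
  · set L := Real.log (1 / (2 * η)) with hL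
    have hLpos : 0 < L := Real.log_pos (by rw [lt_div_iff₀ hq0]; linarith)
    have hLq : Real.log (2 * η) = -L := by rw [hL, one_div, Real.log_inv, neg_neg]
    have hm0 : (0 : ℝ) < m := by positivity
    have hlm : 0 ≤ Real.log m := Real.log_natCast_nonneg m
    have hT : Tendsto (fun ε : ℝ => Real.log (1 / ε)) (𝓝[>] 0) atTop := by
      simp only [one_div]
      exact Real.tendsto_log_atTop.comp tendsto_inv_nhdsGT_zero
    set K := Real.log 2 + (Real.log (2 * R₀) / L + 2) * Real.log m with hK
    have hg : Tendsto (fun ε : ℝ => Real.log m / L + K / Real.log (1 / ε)) (𝓝[>] 0)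
        (𝓝 (Real.log m / L)) := by
      simpa using (tendsto_const_nhds (x := Real.log m / L)).add (hT.const_div_atTop K)
    have hpos : ∀ᶠ ε : ℝ in 𝓝[>] 0, 0 < Real.log (1 / ε) := hT.eventually_gt_atTop 0
    have hev0 : ∀ᶠ ε : ℝ in 𝓝[>] 0,
        0 ≤ Real.log (coverNum E ε) / Real.log (1 / ε) := by
      filter_upwards [hpos] with ε h
      exact div_nonneg (Real.log_natCast_nonneg _) h.le
    have hev : ∀ᶠ ε : ℝ in 𝓝[>] 0, Real.log (coverNum E ε) / Real.log (1 / ε) ≤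
        Real.log m / L + K / Real.log (1 / ε) := by
      filter_upwards [hpos, Ioo_mem_nhdsGT (show (0 : ℝ) < 2 * R₀ by positivity)] with ε h hε
      obtain ⟨hε0, hε1⟩ := hε
      have hA : 0 < Real.log (2 * R₀ / ε) := Real.log_pos (by rwa [lt_div_iff₀ hε0, one_mul])
      have hAeq : Real.log (2 * R₀ / ε) = Real.log (2 * R₀) + Real.log (1 / ε) := by
        rw [← Real.log_mul (by positivity) (by positivity)]; ring_nf
      set k := ⌈Real.log (2 * R₀ / ε) / L⌉₊ with hk
      have hk1 : 1 ≤ k := Nat.ceil_pos.mpr (by positivity)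
      have hkl : Real.log (2 * R₀ / ε) / L ≤ k := Nat.le_ceil _
      have hku : (k : ℝ) < Real.log (2 * R₀ / ε) / L + 1 := Nat.ceil_lt_add_one (by positivity)
      have hpow : 4 * R₀ * (2 * η) ^ k ≤ 2 * ε := by
        have h1 : (2 * η) ^ k ≤ ε / (2 * R₀) := by
          rw [← Real.log_le_log_iff (by positivity) (by positivity), Real.log_pow, hLq]
          rw [div_le_iff₀ hLpos] at hkl
          have : Real.log (ε / (2 * R₀)) = - Real.log (2 * R₀ / ε) := by
            rw [← Real.log_inv, inv_div]
          rw [this]; linarith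
        rw [le_div_iff₀ (by positivity)] at h1
        linarith
      obtain ⟨C, hc, hC, hE⟩ := hcover k hk1
      have hN : coverNum E ε ≤ 2 * m ^ (k + 1) := by
        apply Nat.sInf_le
        exact ⟨C, hc, fun s hs => ⟨(hC s hs).1, (hC s hs).2.trans
          (ENNReal.ofReal_le_ofReal hpow)⟩, hE⟩
      have hlogN : Real.log (coverNum E ε) ≤ Real.log 2 + (k + 1) * Real.log m := by
        have h3 : Real.log 2 + (k + 1) * Real.log m = Real.log ((2 * m ^ (k + 1) : ℕ) : ℝ) := by
          push_cast
          rw [Real.log_mul (by norm_num) (by positivity), Real.log_pow]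
          push_cast; ring
        rcases Nat.eq_zero_or_pos (coverNum E ε) with h0 | h0
        · rw [h0, h3, Nat.cast_zero, Real.log_zero]
          exact Real.log_natCast_nonneg _
        · rw [h3]
          exact Real.log_le_log (by exact_mod_cast h0) (by exact_mod_cast hN)
      rw [div_le_iff₀ h, add_mul, div_mul_cancel₀ _ h.ne']
      have h4 : ((k : ℝ) + 1) * Real.log m ≤
          (Real.log (2 * R₀ / ε) / L + 2) * Real.log m :=
        mul_le_mul_of_nonneg_right (by linarith) hlm
      calc _ ≤ _ := hlogN
        _ ≤ Real.log 2 + (Real.log (2 * R₀ / ε) / L + 2) * Real.log m := by linarith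
        _ = _ := by rw [hAeq, hK]; ring
    unfold fractalDim
    rw [← hg.limsup_eq]
    refine Filter.limsup_le_limsup hev ?_ hg.isBoundedUnder_le
    exact Filter.IsBoundedUnder.isCoboundedUnder_le ⟨0, by simpa using hev0⟩
end

section
/- Let U be a process on a family {X_t}_{t∈ℝ} of normed real vector spaces, R₀ > 0, and B = {B(t)}_{t∈ℝ} a family of nonempty subsets with B(t) contained in the closed ball of radius R₀ of X_t and U(t,t−τ)B(t−τ) ⊆ B(t) for all τ ≥ 1 and t ∈ ℝ. Let t₀ ∈ ℝ, let n_* ∈ ℤ satisfy t₀ − n_* ∈ [0,1), and for t ∈ ℝ set n_t = ⌊t⌋ if t ≤ t₀ and n_t = n_* if t > t₀. Let η ∈ (0,1/2) and let {E(n)}_{n∈ℤ, n ≤ n_*} satisfy: each E(n) is a nonempty compact subset of X_n with E(n) ⊆ U(n,n−1)B(n−1); U(n,l)E(l) ⊆ E(n) for all l ≤ n ≤ n_*; and dist_{X_n}(U(n,n−k)B(n−k), E(n)) ≤ 2R₀(2η)^k for all k ≥ 1 and n ≤ n_*. Assume also that for each t ∈ ℝ there is L_t > 0 with ‖U(t,n_t)x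 − U(t,n_t)y‖_{X_t} ≤ L_t‖x−y‖_{X_{n_t}} for all x,y ∈ B(n_t). Define E(t) = U(t,n_t)E(n_t) for t ∈ ℝ. Then: (a) E(t) ⊆ B(t) and E(t) is compact in X_t for every t ∈ ℝ; (b) the family {E(t)}_{t∈ℝ} is semi-invariant, i.e. U(r,t)E(t) ⊆ E(r) for all t ≤ r; (c) with β = ln(1/(2η)), τ_t = 3 for t ≤ t₀ and τ_t = 3 + t − t₀ for t > t₀, and C(t) = 2L_tR₀e^{βτ_t}, one has dist_{X_t}(U(t,t−τ)B(t−τ), E(t)) ≤ C(t)e^{−βτ} for all t ∈ ℝ and τ ≥ τ_t. -/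
open Filter Topology Set
open scoped ENNReal

/-- The discrete time `n_t` associated with `t`: `⌊t⌋` if `t ≤ t₀` and `n_*` if `t > t₀`. -/
noncomputable def ntIdx (t₀ : ℝ) (nstar : ℤ) (t : ℝ) : ℤ :=
  if t ≤ t₀ then ⌊t⌋ else nstar

/-- Step 4 of the proof of Theorem 3.2 (with `T = 1`): extension of the discrete family
`{E(n)}_{n ≤ n_*}` to all times via `E(t) = U(t,n_t)E(n_t)`: the extended family lies in
`B`, has compact sections, is semi-invariant, and pullback attracts `B` exponentially with
rate `β = ln(1/(2η))`, constants `τ_t = 3` (`t ≤ t₀`), `τ_t = 3 + t - t₀` (`t > t₀`) and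
`C(t) = 2 L_t R₀ e^{β τ_t}`. -/
theorem extension_of_discrete_exponential_attractor
    (X : ℝ → Type*) [∀ t, NormedAddCommGroup (X t)] [∀ t, NormedSpace ℝ (X t)]
    (U : (t τ : ℝ) → X τ → X t)
    (hUid : ∀ (τ : ℝ) (x : X τ), U τ τ x = x)
    (hUcomp : ∀ (t s τ : ℝ), τ ≤ s → s ≤ t →
      ∀ x : X τ, U t s (U s τ x) = U t τ x)
    (R₀ : ℝ) (hR₀ : 0 < R₀)
    (B : (t : ℝ) → Set (X t)) (hBne : ∀ t, (B t).Nonempty)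
    (hBball : ∀ t, B t ⊆ Metric.closedBall (0 : X t) R₀)
    (hBabs : ∀ (t τ : ℝ), 1 ≤ τ → U t (t - τ) '' B (t - τ) ⊆ B t)
    (t₀ : ℝ) (nstar : ℤ) (hnstar : 0 ≤ t₀ - nstar ∧ t₀ - nstar < 1)
    (η : ℝ) (hη₀ : 0 < η) (hη₁ : η < 1 / 2)
    (En : (n : ℤ) → Set (X (n : ℝ)))
    (hEnne : ∀ n : ℤ, n ≤ nstar → (En n).Nonempty)
    (hEncpt : ∀ n : ℤ, n ≤ nstar → IsCompact (En n))
    (hEnB : ∀ n : ℤ, n ≤ nstar → En n ⊆ U (n : ℝ) ((n : ℝ) - 1) '' B ((n : ℝ) - 1))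
    (hEninv : ∀ l n : ℤ, l ≤ n → n ≤ nstar → U (n : ℝ) (l : ℝ) '' En l ⊆ En n)
    (hEnattr : ∀ n : ℤ, n ≤ nstar → ∀ k : ℕ, 1 ≤ k →
      hsd (U (n : ℝ) ((n : ℝ) - k) '' B ((n : ℝ) - k)) (En n) ≤
        ENNReal.ofReal (2 * R₀ * (2 * η) ^ k))
    (L : ℝ → ℝ) (hL : ∀ t, 0 < L t)
    (hLip : ∀ t : ℝ, ∀ x ∈ B ((ntIdx t₀ nstar t : ℤ) : ℝ), ∀ y ∈ B ((ntIdx t₀ nstar t : ℤ) : ℝ),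
      ‖U t ((ntIdx t₀ nstar t : ℤ) : ℝ) x - U t ((ntIdx t₀ nstar t : ℤ) : ℝ) y‖ ≤
        L t * ‖x - y‖) :
    -- (a)
    (∀ t : ℝ, U t ((ntIdx t₀ nstar t : ℤ) : ℝ) '' En (ntIdx t₀ nstar t) ⊆ B t ∧
      IsCompact (U t ((ntIdx t₀ nstar t : ℤ) : ℝ) '' En (ntIdx t₀ nstar t))) ∧
    -- (b)
    (∀ t r : ℝ, t ≤ r →
      U r t '' (U t ((ntIdx t₀ nstar t : ℤ) : ℝ) '' En (ntIdx t₀ nstar t)) ⊆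
        U r ((ntIdx t₀ nstar r : ℤ) : ℝ) '' En (ntIdx t₀ nstar r)) ∧
    -- (c)
    (∀ t τ : ℝ, (if t ≤ t₀ then (3 : ℝ) else 3 + t - t₀) ≤ τ →
      hsd (U t (t - τ) '' B (t - τ)) (U t ((ntIdx t₀ nstar t : ℤ) : ℝ) '' En (ntIdx t₀ nstar t)) ≤
        ENNReal.ofReal
          ((2 * L t * R₀ *
              Real.exp (Real.log (1 / (2 * η)) * (if t ≤ t₀ then (3 : ℝ) else 3 + t - t₀))) *
            Real.exp (-(Real.log (1 / (2 * η))) * τ))) := by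
  have hnle : ∀ t, ntIdx t₀ nstar t ≤ nstar := by
    intro t
    unfold ntIdx
    split_ifs with h
    · have h1 : (⌊t⌋ : ℝ) ≤ t := Int.floor_le t
      have h2 : (⌊t⌋ : ℝ) < (nstar : ℝ) + 1 := by linarith [hnstar.2]
      have h3 : ⌊t⌋ < nstar + 1 := by exact_mod_cast h2
      omega
    · exact le_rfl
  have hnt : ∀ t, ((ntIdx t₀ nstar t : ℤ) : ℝ) ≤ t := by
    intro t
    unfold ntIdx
    split_ifs with h
    · exact Int.floor_le t
    · linarith [hnstar.1]
  have hmono : ∀ t r, t ≤ r → ntIdx t₀ nstar t ≤ ntIdx t₀ nstar r := by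
    intro t r h
    by_cases hr : r ≤ t₀
    · unfold ntIdx
      rw [if_pos hr, if_pos (h.trans hr)]
      exact Int.floor_mono h
    · have : ntIdx t₀ nstar r = nstar := by unfold ntIdx; rw [if_neg hr]
      rw [this]
      exact hnle t
  have hgap : ∀ t, t - ((ntIdx t₀ nstar t : ℤ) : ℝ) + 2 <
      (if t ≤ t₀ then (3 : ℝ) else 3 + t - t₀) := by
    intro t
    unfold ntIdx
    split_ifs with h
    · linarith [Int.lt_floor_add_one t]
    · linarith [hnstar.2]
  have hB : ∀ s t : ℝ, s + 1 ≤ t → ∀ x ∈ B s, U t s x ∈ B t := by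
    intro s t h x hx
    have h1 := hBabs t (t - s) (by linarith)
    rw [sub_sub_cancel] at h1
    exact h1 ⟨x, hx, rfl⟩
  have hEB : ∀ n : ℤ, n ≤ nstar → En n ⊆ B (n : ℝ) := by
    intro n hn x hx
    obtain ⟨b, hb, rfl⟩ := hEnB n hn hx
    exact hB _ _ (by linarith) b hb
  refine ⟨fun t => ⟨?_, ?_⟩, ?_, ?_⟩
  · rintro _ ⟨x, hx, rfl⟩
    obtain ⟨b, hb, rfl⟩ := hEnB _ (hnle t) hx
    rw [hUcomp _ _ _ (by linarith) (hnt t)]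
    exact hB _ _ (by linarith [hnt t]) b hb
  · refine (hEncpt _ (hnle t)).image_of_continuousOn ?_
    have : LipschitzOnWith (L t).toNNReal (U t ((ntIdx t₀ nstar t : ℤ) : ℝ))
        (B ((ntIdx t₀ nstar t : ℤ) : ℝ)) := by
      refine LipschitzOnWith.of_dist_le_mul fun x hx y hy => ?_
      rw [dist_eq_norm, dist_eq_norm, Real.coe_toNNReal _ (hL t).le]
      exact hLip t x hx y hy
    exact this.continuousOn.mono (hEB _ (hnle t))
  · rintro t r h _ ⟨_, ⟨x, hx, rfl⟩, rfl⟩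
    have hm := hmono t r h
    refine ⟨U _ _ x, hEninv _ _ hm (hnle r) ⟨x, hx, rfl⟩, ?_⟩
    rw [hUcomp _ _ _ (by exact_mod_cast hm) (hnt r), hUcomp _ _ _ (hnt t) h]
  · intro t τ hτ
    have hg := hgap t
    have hn := hnle t
    have hnt' := hnt t
    have hlip := hLip t
    generalize (if t ≤ t₀ then (3 : ℝ) else 3 + t - t₀) = T at *
    generalize ntIdx t₀ nstar t = n at *
    have hk : ∃ k : ℕ, 1 ≤ k ∧ τ - T ≤ k ∧ t - τ + 1 ≤ (n : ℝ) - k := by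
      have h0 : (2 : ℝ) ≤ (n : ℝ) - t + τ := by linarith
      have h2 : 2 ≤ ⌊(n : ℝ) - t + τ⌋₊ := Nat.le_floor (by exact_mod_cast h0)
      have h3 := Nat.floor_le (show 0 ≤ (n : ℝ) - t + τ by linarith)
      have h4 := Nat.lt_floor_add_one ((n : ℝ) - t + τ)
      refine ⟨⌊(n : ℝ) - t + τ⌋₊ - 1, by omega, ?_, ?_⟩
      · rw [Nat.cast_sub (by omega)]; push_cast; linarith
      · rw [Nat.cast_sub (by omega)]; push_cast; linarith
    obtain ⟨k, hk1, hkT, hkn⟩ := hk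
    have hk1' : (1 : ℝ) ≤ k := by exact_mod_cast hk1
    unfold hsd
    refine iSup₂_le ?_
    rintro _ ⟨b, hb, rfl⟩
    have hc := hB _ _ hkn b hb
    have hz := hB ((n : ℝ) - k) n (by linarith) _ hc
    have hat : EMetric.infEdist (U n ((n : ℝ) - k) (U ((n : ℝ) - k) (t - τ) b)) (En n) ≤ _ :=
      (le_iSup₂ (f := fun x (_ : x ∈ U (n : ℝ) ((n : ℝ) - k) '' B ((n : ℝ) - k)) =>
        EMetric.infEdist x (En n)) _ ⟨_, hc, rfl⟩).trans (hEnattr n hn k hk1)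
    obtain ⟨y, hy, hye⟩ := (hEncpt n hn).exists_infEdist_eq_edist (hEnne n hn)
      (U n ((n : ℝ) - k) (U ((n : ℝ) - k) (t - τ) b))
    have hcomp : U t (t - τ) b = U t n (U n ((n : ℝ) - k) (U ((n : ℝ) - k) (t - τ) b)) := by
      rw [hUcomp n _ _ (by linarith) (by linarith), hUcomp t _ _ (by linarith) hnt']
    rw [hcomp]
    generalize U n ((n : ℝ) - k) (U ((n : ℝ) - k) (t - τ) b) = z at *
    have hd : ‖z - y‖ ≤ 2 * R₀ * (2 * η) ^ k := by
      have h1 := hye.symm.trans_le hat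
      rwa [edist_dist, ENNReal.ofReal_le_ofReal_iff (by positivity), dist_eq_norm] at h1
    refine (Metric.infEDist_le_edist_of_mem (mem_image_of_mem _ hy)).trans ?_
    rw [edist_dist, dist_eq_norm]
    refine ENNReal.ofReal_le_ofReal ?_
    refine (hlip z hz y (hEB n hn hy)).trans ?_
    have hLt := hL t
    have h2η : 0 < 2 * η := by positivity
    have hlog : Real.log (2 * η) ≤ 0 := Real.log_nonpos h2η.le (by linarith)
    have hpow : (2 * η) ^ k ≤ Real.exp (Real.log (1 / (2 * η)) * T) *
        Real.exp (-(Real.log (1 / (2 * η))) * τ) := by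
      rw [← Real.exp_add, one_div, Real.log_inv, ← Real.rpow_natCast,
        Real.rpow_def_of_pos h2η]
      apply Real.exp_le_exp.mpr
      nlinarith
    calc L t * ‖z - y‖ ≤ L t * (2 * R₀ * (2 * η) ^ k) := by gcongr
      _ ≤ L t * (2 * R₀ * (Real.exp (Real.log (1 / (2 * η)) * T) *
        Real.exp (-(Real.log (1 / (2 * η))) * τ))) := by gcongr
      _ = _ := by ring
end
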